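/- arXiv:2104.02222 — 17 statements merged into one kernel-verified Lean document; each statement's English description precedes it below -/
import Mathlib

section
/- Let n ≥ 1, let r_i ≥ 0 and b_i ≥ 0 for 1 ≤ i ≤ n, and let the deadlines satisfy d_1 > d_2 > … > d_n > 0. Define SC_i(t) = 0 for 0 ≤ t < d_i and SC_i(t) = b_i + r_i·(t − d_i) for t ≥ d_i. Then max{ Σ_{i=1}^n r_i , sup_{t > 0} (Σ_{i=1}^n SC_i(t))/t } = max_{1 ≤ h ≤ n} max{ Σ_{i=1}^n r_i , (Σ_{i=h}^n (b_i + r_i·(d_h − d_i)))/d_h }. Consequently, the minimum bandwidth R* of a link that can accommodate the service curves SC_1, …, SC_n (i.e., the least R with R ≥ Σ r_i and R·t ≥ Σ_i SC_i(t) for all t > 0) is given by the right-hand side. (Proposition 3.1, part 2, Eq. (3).) -/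
/-- The total shifted service curve at the deadline `d h` only involves the flows `i ≥ h`. -/
lemma sum_shifted_service_curve_deadline {n : ℕ} {r b d : Fin n → ℝ}
    (hd : ∀ i, 0 < d i) (hdec : ∀ i j : Fin n, i < j → d j < d i)
    {SC : Fin n → ℝ → ℝ}
    (hSC1 : ∀ i, ∀ t : ℝ, 0 ≤ t → t < d i → SC i t = 0)
    (hSC2 : ∀ i, ∀ t : ℝ, d i ≤ t → SC i t = b i + r i * (t - d i)) (h : Fin n) :
    ∑ i, SC i (d h) =
      ∑ i ∈ Finset.univ.filter (fun i => h ≤ i), (b i + r i * (d h - d i)) := by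
  rw [Finset.sum_filter]
  refine Finset.sum_congr rfl fun i _ => ?_
  split_ifs with hi
  · refine hSC2 i _ ?_
    rcases hi.eq_or_lt with rfl | hlt
    · exact le_rfl
    · exact (hdec _ _ hlt).le
  · exact hSC1 i _ (hd h).le (hdec _ _ (not_le.mp hi))

/-- A bandwidth that dominates the total rate and serves the demand at every deadline
serves the demand at every time. -/
lemma sum_shifted_service_curve_le {n : ℕ} {r b d : Fin n → ℝ}
    (hr : ∀ i, 0 ≤ r i) (hd : ∀ i, 0 < d i)
    {SC : Fin n → ℝ → ℝ}
    (hSC1 : ∀ i, ∀ t : ℝ, 0 ≤ t → t < d i → SC i t = 0)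
    (hSC2 : ∀ i, ∀ t : ℝ, d i ≤ t → SC i t = b i + r i * (t - d i))
    {R : ℝ} (hR : ∑ i, r i ≤ R) (hRd : ∀ h, ∑ i, SC i (d h) ≤ R * d h)
    {t : ℝ} (ht : 0 < t) : ∑ i, SC i t ≤ R * t := by
  have hR0 : 0 ≤ R := (Finset.sum_nonneg fun i _ => hr i).trans hR
  by_cases hne : ∃ i, d i ≤ t
  · obtain ⟨h, hht, hmax⟩ : ∃ h, d h ≤ t ∧ ∀ i, d i ≤ t → d i ≤ d h := by
      obtain ⟨i₀, hi₀⟩ := hne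
      obtain ⟨h, hh, hmax⟩ := Finset.exists_max_image
        (Finset.univ.filter fun i => d i ≤ t) d ⟨i₀, by simpa using hi₀⟩
      exact ⟨h, by simpa using hh, fun i hi => hmax i (by simpa using hi)⟩
    have hstep : ∀ i, SC i t ≤ SC i (d h) + r i * (t - d h) := by
      intro i
      rcases le_or_gt (d i) t with hi | hi
      · rw [hSC2 i t hi, hSC2 i _ (hmax i hi)]
        linarith
      · rw [hSC1 i t ht.le hi, hSC1 i _ (hd h).le (hht.trans_lt hi), zero_add]
        exact mul_nonneg (hr i) (sub_nonneg.mpr hht)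
    calc ∑ i, SC i t ≤ ∑ i, (SC i (d h) + r i * (t - d h)) :=
          Finset.sum_le_sum fun i _ => hstep i
      _ = ∑ i, SC i (d h) + (∑ i, r i) * (t - d h) := by
          rw [Finset.sum_add_distrib, Finset.sum_mul]
      _ ≤ R * d h + R * (t - d h) :=
          add_le_add (hRd h) (mul_le_mul_of_nonneg_right hR (sub_nonneg.mpr hht))
      _ = R * t := by ring
  · push Not at hne
    rw [Finset.sum_eq_zero fun i _ => hSC1 i t ht.le (hne i)]
    positivity

/-- Proposition 3.1, part 2 (Eq. (3)): the minimum bandwidth accommodating the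
shifted service curves `SC_1, …, SC_n` is
`R* = max_{1 ≤ h ≤ n} max{ Σ r_i , (Σ_{i=h}^n (b_i + r_i (d_h − d_i)))/d_h }`. -/
theorem min_bandwidth_shifted_service_curves (n : ℕ) (hn : 0 < n)
    (r b d : Fin n → ℝ)
    (hr : ∀ i, 0 ≤ r i) (hb : ∀ i, 0 ≤ b i)
    (hd : ∀ i, 0 < d i) (hdec : ∀ i j : Fin n, i < j → d j < d i)
    (SC : Fin n → ℝ → ℝ)
    (hSC1 : ∀ i, ∀ t : ℝ, 0 ≤ t → t < d i → SC i t = 0)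
    (hSC2 : ∀ i, ∀ t : ℝ, d i ≤ t → SC i t = b i + r i * (t - d i)) :
    max (∑ i, r i) (sSup {x : ℝ | ∃ t : ℝ, 0 < t ∧ x = (∑ i, SC i t) / t}) =
      Finset.univ.sup' (Finset.univ_nonempty_iff.mpr ⟨⟨0, hn⟩⟩)
        (fun h : Fin n => max (∑ i, r i)
          ((∑ i ∈ Finset.univ.filter (fun i => h ≤ i),
              (b i + r i * (d h - d i))) / d h)) ∧
    IsLeast {R : ℝ | (∑ i, r i) ≤ R ∧ ∀ t : ℝ, 0 < t → (∑ i, SC i t) ≤ R * t}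
      (Finset.univ.sup' (Finset.univ_nonempty_iff.mpr ⟨⟨0, hn⟩⟩)
        (fun h : Fin n => max (∑ i, r i)
          ((∑ i ∈ Finset.univ.filter (fun i => h ≤ i),
              (b i + r i * (d h - d i))) / d h))) := by
  simp only [← sum_shifted_service_curve_deadline hd hdec hSC1 hSC2]
  set M := Finset.univ.sup' (Finset.univ_nonempty_iff.mpr ⟨⟨0, hn⟩⟩)
    (fun h : Fin n => max (∑ i, r i) ((∑ i, SC i (d h)) / d h))
  have hle : ∀ h, max (∑ i, r i) ((∑ i, SC i (d h)) / d h) ≤ M := fun h =>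
    Finset.le_sup' (fun h : Fin n => max (∑ i, r i) ((∑ i, SC i (d h)) / d h))
      (Finset.mem_univ h)
  have hMr : ∑ i, r i ≤ M := (le_max_left _ _).trans (hle ⟨0, hn⟩)
  have hMt : ∀ t : ℝ, 0 < t → ∑ i, SC i t ≤ M * t := fun t ht =>
    sum_shifted_service_curve_le hr hd hSC1 hSC2 hMr
      (fun h => (div_le_iff₀ (hd h)).mp ((le_max_right _ _).trans (hle h))) ht
  have hub : M ∈ upperBounds {x : ℝ | ∃ t : ℝ, 0 < t ∧ x = (∑ i, SC i t) / t} := by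
    rintro x ⟨t, ht, rfl⟩
    exact (div_le_iff₀ ht).mpr (hMt t ht)
  refine ⟨le_antisymm (max_le hMr (csSup_le ⟨_, 1, one_pos, rfl⟩ hub)) ?_, ⟨hMr, hMt⟩, ?_⟩
  · exact Finset.sup'_le _ _ fun h _ =>
      max_le_max le_rfl (le_csSup ⟨M, hub⟩ ⟨d h, hd h, rfl⟩)
  · rintro R ⟨hRr, hRt⟩
    exact Finset.sup'_le _ _ fun h _ =>
      max_le hRr ((div_le_iff₀ (hd h)).mpr (hRt _ (hd h)))
end

section
/- Let r ≥ 0, b ≥ 0 and d > 0, and let Ŝ : [0, ∞) → ℝ be nondecreasing and nonnegative. Suppose that Ŝ meets the deadline d for a flow with token-bucket envelope (r, b), in the sense that for every t ≥ 0 there exists τ ∈ [0, d] with b + r·t ≤ Ŝ(t + τ). Then Ŝ(t) ≥ SC(t) for all t ≥ 0, where SC(t) = 0 for t < d and SC(t) = b + r·(t − d) for t ≥ d. That is, any service guarantee that meets a flow's deadline must dominate the shifted service curve SC. (Core of Proposition 3.1, part 3.) -/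
/-- Core of Proposition 3.1, part 3: any nondecreasing nonnegative service
guarantee `S` that meets the deadline `d` of a token-bucket `(r, b)` flow must
dominate the shifted service curve `SC`. -/
theorem deadline_meeting_service_dominates_shifted_curve
    (r b d : ℝ) (hr : 0 ≤ r) (hb : 0 ≤ b) (hd : 0 < d)
    (S : ℝ → ℝ) (hmono : MonotoneOn S (Set.Ici (0 : ℝ)))
    (hnn : ∀ t : ℝ, 0 ≤ t → 0 ≤ S t)
    (hmeet : ∀ t : ℝ, 0 ≤ t → ∃ τ : ℝ, 0 ≤ τ ∧ τ ≤ d ∧ b + r * t ≤ S (t + τ)) :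
    ∀ t : ℝ, 0 ≤ t → (if t < d then (0 : ℝ) else b + r * (t - d)) ≤ S t := by
  intro t ht
  split_ifs with h
  · exact hnn t ht
  · have htd : 0 ≤ t - d := sub_nonneg.mpr (not_lt.mp h)
    obtain ⟨τ, hτ, hτd, hS⟩ := hmeet (t - d) htd
    exact hS.trans (hmono (Set.mem_Ici.mpr (add_nonneg htd hτ)) ht (by linarith))
end

section
/- Let n ≥ 1, r_i ≥ 0, b_i ≥ 0, and deadlines d_1 > d_2 > … > d_n > 0. Define R̃* = max_{1 ≤ h ≤ n} max{ Σ_{i=1}^n r_i , (Σ_{i=h}^n b_i)/d_h + Σ_{i=h+1}^n r_i } (minimum bandwidth under a static-priority scheduler, Eq. (4)) and R* = max_{1 ≤ h ≤ n} max{ Σ_{i=1}^n r_i , (Σ_{i=h}^n b_i)/d_h + Σ_{i=h+1}^n r_i·(1 − d_i/d_h) } (optimal minimum bandwidth, Eq. (5)). Then (a) R* ≤ R̃*; (b) R̃* = Σ_{i=1}^n r_i if and only if Σ_{i=h}^n b_i ≤ d_h·Σ_{i=1}^h r_i for every 1 ≤ h ≤ n, and in that case R* = R̃* = Σ_{i=1}^n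 r_i. (Section 5.1, comparison of Eqs. (4) and (5).) -/
theorem Finset.le_sup'_max {ι : Type*} {s : Finset ι} (hs : s.Nonempty) (c : ℝ) (f : ι → ℝ) :
    c ≤ s.sup' hs (fun i => max c (f i)) := by
  obtain ⟨i, hi⟩ := hs
  exact (le_max_left c (f i)).trans (Finset.le_sup' (fun i => max c (f i)) hi)

theorem Finset.sup'_max_eq_left_iff {ι : Type*} {s : Finset ι} (hs : s.Nonempty) (c : ℝ)
    (f : ι → ℝ) : s.sup' hs (fun i => max c (f i)) = c ↔ ∀ i ∈ s, f i ≤ c := by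
  rw [le_antisymm_iff, and_iff_left (Finset.le_sup'_max hs c f)]
  simp

theorem Fin.sum_filter_le_add_sum_filter_lt {n : ℕ} (r : Fin n → ℝ) (h : Fin n) :
    ∑ i ∈ Finset.univ.filter (fun i => i ≤ h), r i +
      ∑ i ∈ Finset.univ.filter (fun i => h < i), r i = ∑ i, r i := by
  simpa only [not_le] using Finset.sum_filter_add_sum_filter_not Finset.univ (fun i => i ≤ h) r

/-- Section 5.1 (comparison of Eqs. (4) and (5)): the static-priority minimum
bandwidth `R̃*` dominates the optimal one `R*`, and `R̃* = Σ r_i` (in which case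
they coincide) exactly when `Σ_{i=h}^n b_i ≤ d_h Σ_{i=1}^h r_i` for all `h`. -/
theorem static_priority_vs_optimal_bandwidth
    (n : ℕ) (hn : 0 < n) (r b d : Fin n → ℝ)
    (hr : ∀ i, 0 ≤ r i) (hb : ∀ i, 0 ≤ b i)
    (hd : ∀ i, 0 < d i) (hdec : ∀ i j : Fin n, i < j → d j < d i)
    (Rt Rs : ℝ)
    (hRt : Rt = Finset.univ.sup' (Finset.univ_nonempty_iff.mpr ⟨⟨0, hn⟩⟩)
      (fun h : Fin n => max (∑ i, r i)
        ((∑ i ∈ Finset.univ.filter (fun i => h ≤ i), b i) / d h +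
          ∑ i ∈ Finset.univ.filter (fun i => h < i), r i)))
    (hRs : Rs = Finset.univ.sup' (Finset.univ_nonempty_iff.mpr ⟨⟨0, hn⟩⟩)
      (fun h : Fin n => max (∑ i, r i)
        ((∑ i ∈ Finset.univ.filter (fun i => h ≤ i), b i) / d h +
          ∑ i ∈ Finset.univ.filter (fun i => h < i), r i * (1 - d i / d h)))) :
    Rs ≤ Rt ∧
    (Rt = ∑ i, r i ↔ ∀ h : Fin n,
      (∑ i ∈ Finset.univ.filter (fun i => h ≤ i), b i) ≤
        d h * ∑ i ∈ Finset.univ.filter (fun i => i ≤ h), r i) ∧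
    ((∀ h : Fin n,
      (∑ i ∈ Finset.univ.filter (fun i => h ≤ i), b i) ≤
        d h * ∑ i ∈ Finset.univ.filter (fun i => i ≤ h), r i) →
      Rs = ∑ i, r i ∧ Rt = ∑ i, r i) := by
  have hle : Rs ≤ Rt := by
    rw [hRs, hRt]
    refine Finset.sup'_mono_fun fun h _ => ?_
    gcongr with i
    exact mul_le_of_le_one_right (hr i) (sub_le_self _ (div_pos (hd i) (hd h)).le)
  have hiff : Rt = ∑ i, r i ↔ ∀ h : Fin n,
      (∑ i ∈ Finset.univ.filter (fun i => h ≤ i), b i) ≤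
        d h * ∑ i ∈ Finset.univ.filter (fun i => i ≤ h), r i := by
    rw [hRt, Finset.sup'_max_eq_left_iff]
    simp only [Finset.mem_univ, true_imp_iff]
    refine forall_congr' fun h => ?_
    rw [← Fin.sum_filter_le_add_sum_filter_lt r h, add_le_add_iff_right, div_le_iff₀' (hd h)]
  refine ⟨hle, hiff, fun h => ?_⟩
  have hRt_eq := hiff.mpr h
  exact ⟨le_antisymm (hle.trans_eq hRt_eq) (hRs ▸ Finset.le_sup'_max _ _ _), hRt_eq⟩
end

section
/- Let r_1, r_2, b_1, b_2 ≥ 0 and 0 < d_2 ≤ d_1. Then max{ r_1 + r_2 , b_2/d_2 , (b_1 + b_2)/d_1 + r_2 } ≤ 2 · max{ r_1 + r_2 , b_2/d_2 , (b_1 + b_2 − r_2·d_2)/d_1 + r_2 }; that is, in the two-flow case the minimum bandwidth required by a static-priority scheduler is at most twice the minimum bandwidth required by the optimal (dynamic-priority) scheduler. (Section 5.1, two-flow worst case.) -/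
/-- Section 5.1, two-flow worst case: the minimum bandwidth required by a
static-priority scheduler is at most twice the minimum bandwidth required by
the optimal (dynamic-priority) scheduler. -/
theorem static_priority_at_most_twice_optimal_two_flows
    (r1 r2 b1 b2 d1 d2 : ℝ)
    (hr1 : 0 ≤ r1) (hr2 : 0 ≤ r2) (hb1 : 0 ≤ b1) (hb2 : 0 ≤ b2)
    (hd2 : 0 < d2) (hd : d2 ≤ d1) :
    max (r1 + r2) (max (b2 / d2) ((b1 + b2) / d1 + r2)) ≤
      2 * max (r1 + r2) (max (b2 / d2) ((b1 + b2 - r2 * d2) / d1 + r2)) := by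
  have hd1 : 0 < d1 := hd2.trans_le hd
  have h_term : r2 * d2 / d1 ≤ r2 := by
    rw [div_le_iff₀ hd1]
    exact mul_le_mul_of_nonneg_left hd hr2
  have h_split : (b1 + b2 - r2 * d2) / d1 = (b1 + b2) / d1 - r2 * d2 / d1 := sub_div _ _ _
  have h_div : 0 ≤ b2 / d2 := div_nonneg hb2 hd2.le
  set M := max (r1 + r2) (max (b2 / d2) ((b1 + b2 - r2 * d2) / d1 + r2))
  have h_rate : r1 + r2 ≤ M := le_max_left _ _
  have h_burst : b2 / d2 ≤ M := (le_max_left _ _).trans (le_max_right _ _)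
  have h_low : (b1 + b2 - r2 * d2) / d1 + r2 ≤ M := (le_max_right _ _).trans (le_max_right _ _)
  refine max_le ?_ (max_le ?_ ?_) <;> linarith
end

section
/- Let r > 0, 0 ≤ b' ≤ b, B ≥ 0 and C ≥ r with C > 0. Define the arrival curve α(0) = 0 and α(t) = b + r·t for t > 0, and the service curve SC(t) = min{ max(0, b' + r·(t − B/C)), max(0, C·t − B) } for t ≥ 0. Then sup_{t ≥ 0} inf{τ ≥ 0 : α(t) ≤ SC(t + τ)} = max{ (b + B)/C , (b − b')/r + B/C }. In the static-priority setting of Proposition 5.2, taking C = R − R_{i+1} and B = B'_{i+1}, this says that the worst-case end-to-end delay of flow i, reshaped from (r_i, b_i) to (r_i, b'_i) and served at a shared link of bandwidth R, is max{ (b_i + B'_{i+1})/(R − R_{i+1}), (b_i − b'_i)/r_i + B'_{i+1}/(R − R_{i+1}) }. (Proposition 5.2, Eq. (8).) -/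
/-- At a time `t > 0` the feasible delays of a token bucket `(r, b)` under the reshaped
static-priority service curve form a closed half-line. -/
theorem feasible_delays_eq_Ici (r b b' B C t : ℝ) (hr : 0 < r) (hb'0 : 0 ≤ b') (hb' : b' ≤ b)
    (hB : 0 ≤ B) (hC0 : 0 < C) (ht : 0 < t) :
    {τ : ℝ | 0 ≤ τ ∧ b + r * t ≤
      min (max 0 (b' + r * (t + τ - B / C))) (max 0 (C * (t + τ) - B))} =
    Set.Ici (max ((b + B + r * t) / C - t) ((b - b') / r + B / C)) := by
  have hpos : 0 < b + r * t := by linarith [mul_pos hr ht]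
  have hdelay : 0 ≤ (b - b') / r + B / C :=
    add_nonneg (div_nonneg (by linarith) hr.le) (div_nonneg hB hC0.le)
  have hlink (τ : ℝ) : (b + B + r * t) / C - t ≤ τ ↔ b + r * t ≤ C * (t + τ) - B := by
    rw [sub_le_iff_le_add, div_le_iff₀ hC0]
    constructor <;> intro h <;> linarith
  have hshaper (τ : ℝ) :
      (b - b') / r + B / C ≤ τ ↔ b + r * t ≤ b' + r * (t + τ - B / C) := by
    rw [← le_sub_iff_add_le, div_le_iff₀ hr]
    constructor <;> intro h <;> linarith
  ext τ
  simp only [Set.mem_ofPred_eq, Set.mem_Ici, le_min_iff, max_le_iff, le_max_iff, hpos.not_ge,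
    false_or, hlink, hshaper]
  constructor
  · rintro ⟨-, h₁, h₂⟩
    exact ⟨h₂, h₁⟩
  · rintro ⟨h₂, h₁⟩
    exact ⟨hdelay.trans ((hshaper τ).2 h₁), h₁, h₂⟩

/-- Proposition 5.2 (Eq. (8)): the worst-case delay of a token-bucket flow
`(r, b)` reshaped to `(r, b')` and served through the concatenated service
curve `SC(t) = min{[b' + r(t − B/C)]⁺, [C t − B]⁺}` equals
`max{ (b + B)/C , (b − b')/r + B/C }`. -/
theorem static_priority_reshaped_worst_case_delay
    (r b b' B C : ℝ) (hr : 0 < r) (hb'0 : 0 ≤ b') (hb' : b' ≤ b)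
    (hB : 0 ≤ B) (hC : r ≤ C) (hC0 : 0 < C)
    (α SC : ℝ → ℝ)
    (hα0 : α 0 = 0) (hα : ∀ t : ℝ, 0 < t → α t = b + r * t)
    (hSC : ∀ t : ℝ, 0 ≤ t →
      SC t = min (max 0 (b' + r * (t - B / C))) (max 0 (C * t - B))) :
    sSup {D : ℝ | ∃ t : ℝ, 0 ≤ t ∧
        D = sInf {τ : ℝ | 0 ≤ τ ∧ α t ≤ SC (t + τ)}} =
      max ((b + B) / C) ((b - b') / r + B / C) := by
  have hdelay : 0 ≤ (b - b') / r + B / C :=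
    add_nonneg (div_nonneg (by linarith) hr.le) (div_nonneg hB hC0.le)
  have hzero : sInf {τ : ℝ | 0 ≤ τ ∧ α 0 ≤ SC (0 + τ)} = 0 := by
    refine IsLeast.csInf_eq ⟨⟨le_rfl, ?_⟩, fun τ hτ => hτ.1⟩
    rw [hα0, hSC _ (by simp)]
    exact le_min (le_max_left _ _) (le_max_left _ _)
  have hinf (t : ℝ) (ht : 0 < t) : sInf {τ : ℝ | 0 ≤ τ ∧ α t ≤ SC (t + τ)} =
      max ((b + B + r * t) / C - t) ((b - b') / r + B / C) := by
    rw [← csInf_Ici (a := max ((b + B + r * t) / C - t) ((b - b') / r + B / C)),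
      ← feasible_delays_eq_Ici r b b' B C t hr hb'0 hb' hB hC0 ht]
    congr 1
    ext τ
    refine and_congr_right fun hτ => ?_
    rw [hα t ht, hSC (t + τ) (by linarith)]
  refine IsLUB.csSup_eq ⟨?_, ?_⟩ ⟨_, 0, le_rfl, rfl⟩
  · rintro D ⟨t, ht, rfl⟩
    rcases ht.eq_or_lt with rfl | ht
    · rw [hzero]
      exact hdelay.trans (le_max_right _ _)
    · rw [hinf t ht]
      refine max_le_max_right _ ?_
      rw [sub_le_iff_le_add, div_le_iff₀ hC0, add_mul, div_mul_cancel₀ _ hC0.ne']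
      nlinarith
  · intro M hM
    have hbound (t : ℝ) (ht : 0 < t) := (hinf t ht).symm.trans_le (hM ⟨t, ht.le, rfl⟩)
    refine max_le (le_of_forall_pos_le_add fun ε hε => ?_)
      ((le_max_right _ _).trans (hbound 1 one_pos))
    have hε' := (le_max_left _ _).trans (hbound ε hε)
    have hmono : (b + B) / C ≤ (b + B + r * ε) / C := by
      refine div_le_div_of_nonneg_right ?_ hC0.le
      linarith [mul_pos hr hε]
    linarith
end

section
/- Let n, k ≥ 1, let r_i ≥ 0 and b_i ≥ 0 for 1 ≤ i ≤ n, and let d_1 > d_2 > … > d_n > 0. For an assignment π : {1,…,n} → {1,…,k} of flows to priority classes (class k highest), define R*(π) = max{ Σ_{i=1}^n r_i , max over those h ∈ {1,…,k} with π⁻¹(h) ≠ ∅ of ( (Σ_{i : π(i) ≥ h} b_i) / (min{d_i : π(i) = h}) + Σ_{i : π(i) > h} r_i ) }. Then there exists an assignment π* minimizing R*(π) over all assignments π such that for all i, j: π*(i) > π*(j) implies d_i < d_j (equivalently, i < j implies π*(i) ≤ π*(j)); i.e., the minimum static-priority bandwidth is achieved by assigning shorter-deadline flows (weakly) higher priorities.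 (Proposition 5.1, fluid version.) -/
/-- The minimum link bandwidth required by a static-priority scheduler under an
assignment `π` of the `n` flows to `k` priority classes (class `k` highest):
`R*(π) = max{ Σ r_i , max over nonempty classes h of
  (Σ_{π(i) ≥ h} b_i)/(min{d_i : π(i) = h}) + Σ_{π(i) > h} r_i }`. -/
noncomputable def staticPriorityBandwidth {n k : ℕ}
    (r b d : Fin n → ℝ) (π : Fin n → Fin k) : ℝ :=
  max (∑ i, r i)
    (sSup {x : ℝ | ∃ h : Fin k, (∃ i, π i = h) ∧
      x = (∑ i ∈ Finset.univ.filter (fun i => h ≤ π i), b i) /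
            sInf {y : ℝ | ∃ i, π i = h ∧ y = d i} +
          ∑ i ∈ Finset.univ.filter (fun i => h < π i), r i})

/-- The assignment giving each flow the lowest class that `π` gives to any flow of equal or larger
index. -/
def suffixInf {n k : ℕ} (π : Fin n → Fin k) (i : Fin n) : Fin k :=
  (Finset.Ici i).inf' ⟨i, Finset.mem_Ici.2 le_rfl⟩ π

theorem suffixInf_le {n k : ℕ} (π : Fin n → Fin k) (i : Fin n) : suffixInf π i ≤ π i :=
  Finset.inf'_le _ (Finset.mem_Ici.2 le_rfl)

theorem suffixInf_mono {n k : ℕ} (π : Fin n → Fin k) : Monotone (suffixInf π) := fun _ _ hij =>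
  Finset.inf'_mono _ (Finset.Ici_subset_Ici.2 hij) _

theorem exists_le_suffixInf_eq {n k : ℕ} (π : Fin n → Fin k) (i : Fin n) :
    ∃ j, i ≤ j ∧ π j = suffixInf π i := by
  obtain ⟨j, hj, h⟩ := Finset.exists_mem_eq_inf' (s := Finset.Ici i) ⟨i, Finset.mem_Ici.2 le_rfl⟩ π
  exact ⟨j, Finset.mem_Ici.1 hj, h.symm⟩

theorem staticPriorityBandwidth_suffixInf_le {n k : ℕ} (hn : 0 < n) {r b d : Fin n → ℝ}
    (hr : ∀ i, 0 ≤ r i) (hb : ∀ i, 0 ≤ b i) (hd : ∀ i, 0 < d i) (hdec : Antitone d)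
    (π : Fin n → Fin k) :
    staticPriorityBandwidth r b d (suffixInf π) ≤ staticPriorityBandwidth r b d π := by
  unfold staticPriorityBandwidth
  refine max_le_max le_rfl (csSup_le ⟨_, suffixInf π ⟨0, hn⟩, ⟨⟨0, hn⟩, rfl⟩, rfl⟩ ?_)
  rintro _ ⟨h, ⟨i, hi⟩, rfl⟩
  obtain ⟨j, -, hj⟩ := exists_le_suffixInf_eq π i
  have hfin : {y : ℝ | ∃ i, π i = h ∧ y = d i}.Finite :=
    (Set.finite_range d).subset (by rintro _ ⟨m, -, rfl⟩; exact ⟨m, rfl⟩)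
  have hpos : 0 < sInf {y : ℝ | ∃ i, π i = h ∧ y = d i} := by
    obtain ⟨m, -, hm⟩ :=
      Set.Nonempty.csInf_mem (s := {y : ℝ | ∃ i, π i = h ∧ y = d i})
        ⟨d j, j, hj.trans hi, rfl⟩ hfin
    exact hm ▸ hd m
  have hle : sInf {y : ℝ | ∃ i, π i = h ∧ y = d i} ≤
      sInf {y : ℝ | ∃ i, suffixInf π i = h ∧ y = d i} := by
    refine le_csInf ⟨d i, i, hi, rfl⟩ ?_
    rintro _ ⟨m, hm, rfl⟩
    obtain ⟨l, hml, hl⟩ := exists_le_suffixInf_eq π m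
    exact (csInf_le hfin.bddBelow ⟨l, hl.trans hm, rfl⟩).trans (hdec hml)
  refine le_csSup_of_le (Set.Finite.bddAbove ?_) ⟨h, ⟨j, hj.trans hi⟩, rfl⟩ (add_le_add ?_ ?_)
  · refine (Set.finite_range fun h : Fin k =>
      (∑ i ∈ Finset.univ.filter (fun i => h ≤ π i), b i) /
        sInf {y : ℝ | ∃ i, π i = h ∧ y = d i} +
          ∑ i ∈ Finset.univ.filter (fun i => h < π i), r i).subset ?_
    rintro _ ⟨m, -, rfl⟩
    exact ⟨m, rfl⟩
  · refine div_le_div₀ (Finset.sum_nonneg fun i _ => hb i) ?_ hpos hle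
    exact Finset.sum_le_sum_of_subset_of_nonneg
      (Finset.monotone_filter_right _ fun m _ hm => hm.trans (suffixInf_le π m))
      fun m _ _ => hb m
  · exact Finset.sum_le_sum_of_subset_of_nonneg
      (Finset.monotone_filter_right _ fun m _ hm => hm.trans_le (suffixInf_le π m))
      fun m _ _ => hr m

/-- Proposition 5.1 (fluid version): the minimum static-priority bandwidth is
achieved by an assignment giving shorter-deadline flows (weakly) higher
priorities. -/
theorem exists_deadline_ordered_optimal_priority_assignment
    (n k : ℕ) (hn : 0 < n) (hk : 0 < k) (r b d : Fin n → ℝ)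
    (hr : ∀ i, 0 ≤ r i) (hb : ∀ i, 0 ≤ b i)
    (hd : ∀ i, 0 < d i) (hdec : ∀ i j : Fin n, i < j → d j < d i) :
    ∃ πstar : Fin n → Fin k,
      (∀ π : Fin n → Fin k,
        staticPriorityBandwidth r b d πstar ≤ staticPriorityBandwidth r b d π) ∧
      (∀ i j : Fin n, πstar j < πstar i → d i < d j) ∧
      (∀ i j : Fin n, i < j → πstar i ≤ πstar j) := by
  have : Nonempty (Fin n → Fin k) := ⟨fun _ => ⟨0, hk⟩⟩
  have hanti : StrictAnti d := fun i j hij => hdec i j hij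
  obtain ⟨π, hπ⟩ := Finite.exists_min (staticPriorityBandwidth (k := k) r b d)
  refine ⟨suffixInf π, fun ρ => ?_, fun i j hij => ?_, fun i j hij => suffixInf_mono π hij.le⟩
  · exact (staticPriorityBandwidth_suffixInf_le hn hr hb hd hanti.antitone π).trans (hπ ρ)
  · exact hanti ((suffixInf_mono π).reflect_lt hij)
end

section
/- Assume the OPT_S setting with n ≥ 2 flows. For 1 ≤ i ≤ n define H_i = b_i − d_i·r_i, Π_i(R) = (r_i + R − R_{i+1})/(R − R_{i+1}) and V_i(R) = d_i·(R − R_{i+1}) − b_i, and define the finite sets S_1(R) = {V_1(R)} and S_i(R) = S_{i−1}(R) ∪ {V_i(R)} ∪ { (s − H_i)/Π_i(R) : s ∈ S_{i−1}(R) } for 2 ≤ i ≤ n. Then for every R ≥ R_1: there exists a reshaping vector b' such that (R, b') is feasible for OPT_S if and only if every element of S_n(R) is nonnegative. Consequently the minimum feasible bandwidth is R̃*_s = max{ R_1, inf{ R : every element of S_n(R) is ≥ 0 } }. (Proposition 5.4 and Lemma C.3.) -/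
/-- Feasibility of `(R, b')` for the static-priority optimization OPT_S with
flows `1, …, n` (flow `n` has the highest priority):  `R ≥ R_1`, `b'_1 = b_1`,
`0 ≤ b'_i ≤ b_i` for `2 ≤ i ≤ n`, and each flow's worst-case delay
`max{ (b_i + B'_{i+1})/(R − R_{i+1}), (b_i − b'_i)/r_i + B'_{i+1}/(R − R_{i+1}) }`
is at most `d_i`. -/
def OPTSFeasible (r b d : ℕ → ℝ) (n : ℕ) (R : ℝ) (b' : ℕ → ℝ) : Prop :=
  (∑ j ∈ Finset.Icc 1 n, r j) ≤ R ∧ b' 1 = b 1 ∧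
  (∀ i ∈ Finset.Icc 2 n, 0 ≤ b' i ∧ b' i ≤ b i) ∧
  ∀ i ∈ Finset.Icc 1 n,
    max ((b i + ∑ j ∈ Finset.Icc (i + 1) n, b' j) /
          (R - ∑ j ∈ Finset.Icc (i + 1) n, r j))
        ((b i - b' i) / r i +
          (∑ j ∈ Finset.Icc (i + 1) n, b' j) /
            (R - ∑ j ∈ Finset.Icc (i + 1) n, r j)) ≤ d i

/-- The finite sets `S_i(R)` of Proposition 5.4: `S_0(R) = ∅`, and
`S_{i+1}(R) = S_i(R) ∪ {V_{i+1}(R)} ∪ {(s − H_{i+1})/Π_{i+1}(R) : s ∈ S_i(R)}`,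
where `H_i = b_i − d_i r_i`, `Π_i(R) = (r_i + R − R_{i+1})/(R − R_{i+1})` and
`V_i(R) = d_i (R − R_{i+1}) − b_i`. -/
noncomputable def OPTSSets (r b d : ℕ → ℝ) (n : ℕ) (R : ℝ) : ℕ → Set ℝ
  | 0 => ∅
  | i + 1 =>
      OPTSSets r b d n R i ∪
        {d (i + 1) * (R - ∑ j ∈ Finset.Icc (i + 2) n, r j) - b (i + 1)} ∪
        ((fun s => (s - (b (i + 1) - d (i + 1) * r (i + 1))) /
            ((r (i + 1) + R - ∑ j ∈ Finset.Icc (i + 2) n, r j) /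
              (R - ∑ j ∈ Finset.Icc (i + 2) n, r j))) '' OPTSSets r b d n R i)

/-- The constraints of flows `1, …, k` when the flows above `k` contribute a total reshaped
burst `x`; unlike `OPTSFeasible`, no lower bound on `R` is imposed. -/
def PrefixFeasible (r b d : ℕ → ℝ) (n : ℕ) (R : ℝ) (k : ℕ) (x : ℝ) (b' : ℕ → ℝ) : Prop :=
  b' 1 = b 1 ∧ (∀ i ∈ Finset.Icc 2 k, 0 ≤ b' i ∧ b' i ≤ b i) ∧
  ∀ i ∈ Finset.Icc 1 k,
    max ((b i + (∑ j ∈ Finset.Icc (i + 1) k, b' j + x)) /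
          (R - ∑ j ∈ Finset.Icc (i + 1) n, r j))
        ((b i - b' i) / r i +
          (∑ j ∈ Finset.Icc (i + 1) k, b' j + x) /
            (R - ∑ j ∈ Finset.Icc (i + 1) n, r j)) ≤ d i

theorem optsFeasible_iff_prefixFeasible {r b d : ℕ → ℝ} {n : ℕ} {R : ℝ} {b' : ℕ → ℝ} :
    OPTSFeasible r b d n R b' ↔
      (∑ j ∈ Finset.Icc 1 n, r j) ≤ R ∧ PrefixFeasible r b d n R n 0 b' := by
  simp only [OPTSFeasible, PrefixFeasible, add_zero]

theorem delay_le_iff {β ρ δ c B y : ℝ} (hc : 0 < c) (hρ : 0 < ρ) :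
    max ((β + B) / c) ((β - y) / ρ + B / c) ≤ δ ↔
      β + B ≤ δ * c ∧ β - δ * ρ + ρ * (B / c) ≤ y := by
  rw [max_le_iff, div_le_iff₀ hc, ← le_sub_iff_add_le (c := δ), div_le_iff₀ hρ, sub_mul,
    mul_comm (B / c)]
  refine and_congr_right fun _ => ⟨fun h => ?_, fun h => ?_⟩ <;> linarith

theorem mul_div_le_of_le_mul {δ c B ρ : ℝ} (hc : 0 < c) (hρ : 0 < ρ) (h : B ≤ δ * c) :
    ρ * (B / c) ≤ δ * ρ := by
  rw [mul_comm δ]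
  exact mul_le_mul_of_nonneg_left ((div_le_iff₀ hc).2 h) hρ.le

theorem le_sub_div_iff {x s h ρ R σ : ℝ} (hc : 0 < R - σ) (hρ : 0 < ρ) :
    x ≤ (s - h) / ((ρ + R - σ) / (R - σ)) ↔ h + ρ * (x / (R - σ)) + x ≤ s := by
  have hgain : (ρ + R - σ) / (R - σ) = ρ / (R - σ) + 1 := by
    rw [add_sub_assoc, add_div, div_self hc.ne']
  have hpos : 0 < ρ / (R - σ) + 1 := by positivity
  rw [hgain, le_div_iff₀ hpos]
  have e : x * (ρ / (R - σ) + 1) = ρ * (x / (R - σ)) + x := by ring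
  rw [e]
  constructor <;> intro h <;> linarith

theorem forall_mem_OPTSSets_one {r b d : ℕ → ℝ} {n : ℕ} {R x : ℝ} :
    (∀ s ∈ OPTSSets r b d n R 1, x ≤ s) ↔
      b 1 + x ≤ d 1 * (R - ∑ j ∈ Finset.Icc 2 n, r j) := by
  simp only [OPTSSets, Set.image_empty, Set.union_empty, Set.empty_union, Set.mem_singleton_iff,
    forall_eq, zero_add]
  constructor <;> intro h <;> linarith

/-- A bound on `S_{k+1}(R)` unfolds to the bound on `S_k(R)` that the least admissible reshaped
burst of flow `k + 1` produces. -/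
theorem forall_mem_OPTSSets_succ {r b d : ℕ → ℝ} {n : ℕ} {R x : ℝ} {k : ℕ}
    (hc : 0 < R - ∑ j ∈ Finset.Icc (k + 1 + 1) n, r j) (hr : 0 < r (k + 1)) :
    (∀ s ∈ OPTSSets r b d n R (k + 1), x ≤ s) ↔
      (∀ s ∈ OPTSSets r b d n R k, x ≤ s) ∧
      b (k + 1) + x ≤ d (k + 1) * (R - ∑ j ∈ Finset.Icc (k + 1 + 1) n, r j) ∧
      ∀ s ∈ OPTSSets r b d n R k, b (k + 1) - d (k + 1) * r (k + 1) +
        r (k + 1) * (x / (R - ∑ j ∈ Finset.Icc (k + 1 + 1) n, r j)) + x ≤ s := by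
  simp only [OPTSSets, Set.mem_union, Set.mem_singleton_iff, or_imp, forall_and, forall_eq,
    Set.forall_mem_image, le_sub_div_iff hc hr, and_assoc]
  refine and_congr_right fun _ => and_congr_left fun _ => ?_
  rw [le_sub_iff_add_le, add_comm]

theorem forall_mem_OPTSSets_iff_exists_prefixFeasible {r b d : ℕ → ℝ} {n : ℕ} {R : ℝ}
    (hr : ∀ i ∈ Finset.Icc 1 n, 0 < r i) (hb : ∀ i ∈ Finset.Icc 1 n, 0 < b i)
    (hc : ∀ i ∈ Finset.Icc 1 n, 0 < R - ∑ j ∈ Finset.Icc (i + 1) n, r j)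
    {k : ℕ} (hk : 1 ≤ k) :
    k ≤ n → ∀ x : ℝ, 0 ≤ x →
      ((∀ s ∈ OPTSSets r b d n R k, x ≤ s) ↔ ∃ b', PrefixFeasible r b d n R k x b') := by
  induction k, hk using Nat.le_induction with
  | base =>
    intro hn x hx
    have h1 : 1 ∈ Finset.Icc 1 n := Finset.mem_Icc.2 ⟨le_rfl, hn⟩
    rw [forall_mem_OPTSSets_one]
    have key : ∀ b' : ℕ → ℝ, PrefixFeasible r b d n R 1 x b' ↔ b' 1 = b 1 ∧
        (b 1 + x ≤ d 1 * (R - ∑ j ∈ Finset.Icc (1 + 1) n, r j) ∧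
        b 1 - d 1 * r 1 + r 1 * (x / (R - ∑ j ∈ Finset.Icc (1 + 1) n, r j)) ≤ b' 1) := by
      intro b'
      rw [← delay_le_iff (hc 1 h1) (hr 1 h1)]
      simp [PrefixFeasible]
    simp only [key]
    refine ⟨fun h => ⟨b, rfl, h, ?_⟩, fun ⟨b', _, h, _⟩ => h⟩
    have := mul_div_le_of_le_mul (B := x) (δ := d 1) (hc 1 h1) (hr 1 h1)
      (by have := hb 1 h1; norm_num at h ⊢; linarith)
    linarith
  | succ k hk ih =>
    intro hn x hx
    have hmem : k + 1 ∈ Finset.Icc 1 n := Finset.mem_Icc.2 ⟨by omega, hn⟩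
    have hck := hc _ hmem
    have hrk := hr _ hmem
    have hbk := hb _ hmem
    rw [forall_mem_OPTSSets_succ hck hrk]
    set c := R - ∑ j ∈ Finset.Icc (k + 1 + 1) n, r j with hcdef
    have sum_top : ∀ (f : ℕ → ℝ), ∀ i ∈ Finset.Icc 1 k,
        ∑ j ∈ Finset.Icc (i + 1) (k + 1), f j + x =
          ∑ j ∈ Finset.Icc (i + 1) k, f j + (f (k + 1) + x) := by
      intro f i hi
      rw [Finset.sum_Icc_succ_top (by have := (Finset.mem_Icc.1 hi).2; omega), add_assoc]
    constructor
    · rintro ⟨hS, hV, hgain⟩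
      set y := max 0 (b (k + 1) - d (k + 1) * r (k + 1) + r (k + 1) * (x / c)) with hy
      have hy0 : 0 ≤ y := le_max_left _ _
      have hyb : y ≤ b (k + 1) := max_le hbk.le (by
        have := mul_div_le_of_le_mul (B := x) (δ := d (k + 1)) hck hrk (by linarith)
        linarith)
      obtain ⟨b', h1, hbd, hdel⟩ := (ih (by omega) (y + x) (by linarith)).1 (fun s hs => by
        rw [hy, max_add]
        exact max_le (by simpa using hS s hs) (hgain s hs))
      have hne : ∀ i ≤ k, Function.update b' (k + 1) y i = b' i := fun i hi =>
        Function.update_of_ne (by omega) _ _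
      refine ⟨Function.update b' (k + 1) y, by rw [hne 1 hk, h1], fun i hi => ?_, fun i hi => ?_⟩
      · rcases (Finset.mem_Icc.1 hi).2.eq_or_lt with rfl | hlt
        · simpa using ⟨hy0, hyb⟩
        · rw [hne i (by omega)]
          exact hbd i (Finset.mem_Icc.2 ⟨(Finset.mem_Icc.1 hi).1, by omega⟩)
      · rcases (Finset.mem_Icc.1 hi).2.eq_or_lt with rfl | hlt
        · rw [delay_le_iff hck hrk]
          simpa using ⟨hV, le_max_right _ _⟩
        · have hi' : i ∈ Finset.Icc 1 k :=
            Finset.mem_Icc.2 ⟨(Finset.mem_Icc.1 hi).1, by omega⟩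
          rw [sum_top _ i hi', Function.update_self, hne i (by omega),
            Finset.sum_congr rfl fun j hj => hne j (Finset.mem_Icc.1 hj).2]
          exact hdel i hi'
    · rintro ⟨b', h1, hbd, hdel⟩
      have hb0 := (hbd (k + 1) (Finset.mem_Icc.2 ⟨by omega, le_rfl⟩)).1
      have hS := (ih (by omega) (b' (k + 1) + x) (by linarith)).2
        ⟨b', h1, fun i hi => hbd i (Finset.Icc_subset_Icc_right (by omega) hi), fun i hi => by
          rw [← sum_top b' i hi]
          exact hdel i (Finset.Icc_subset_Icc_right (by omega) hi)⟩
      have htop := hdel (k + 1) (Finset.mem_Icc.2 ⟨by omega, le_rfl⟩)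
      rw [delay_le_iff hck hrk] at htop
      simp only [Finset.Icc_eq_empty_of_lt (Nat.lt_succ_self (k + 1)), Finset.sum_empty,
        zero_add] at htop
      exact ⟨fun s hs => by linarith [hS s hs], htop.1, fun s hs => by linarith [hS s hs, htop.2]⟩

theorem OPTSSets_mono (r b d : ℕ → ℝ) (n : ℕ) (R : ℝ) : Monotone (OPTSSets r b d n R) :=
  monotone_nat_of_le_succ fun _ _ hs => Or.inl (Or.inl hs)

/-- Since `S_n(R)` contains every `V_i(R)`, its nonnegativity forces positive residual rates. -/
theorem residual_rate_pos_of_OPTSSets_nonneg {r b d : ℕ → ℝ} {n : ℕ} {R : ℝ}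
    (hb : ∀ i ∈ Finset.Icc 1 n, 0 < b i) (hd : ∀ i ∈ Finset.Icc 1 n, 0 < d i)
    (hS : ∀ s ∈ OPTSSets r b d n R n, 0 ≤ s) :
    ∀ i ∈ Finset.Icc 1 n, 0 < R - ∑ j ∈ Finset.Icc (i + 1) n, r j := by
  intro i hi
  obtain ⟨m, rfl⟩ : ∃ m, i = m + 1 := ⟨i - 1, by have := (Finset.mem_Icc.1 hi).1; omega⟩
  have hV := hS _ (OPTSSets_mono r b d n R (Finset.mem_Icc.1 hi).2 (Or.inl (Or.inr rfl)))
  exact pos_of_mul_pos_right (lt_of_lt_of_le (hb _ hi) (sub_nonneg.1 hV)) (hd _ hi).le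

theorem residual_rate_pos_of_sum_le {r : ℕ → ℝ} {n : ℕ} {R : ℝ}
    (hr : ∀ i ∈ Finset.Icc 1 n, 0 < r i) (hR : ∑ j ∈ Finset.Icc 1 n, r j ≤ R) :
    ∀ i ∈ Finset.Icc 1 n, 0 < R - ∑ j ∈ Finset.Icc (i + 1) n, r j := by
  intro i hi
  have : ∑ j ∈ Finset.Icc (i + 1) n, r j < ∑ j ∈ Finset.Icc 1 n, r j :=
    Finset.sum_lt_sum_of_subset (Finset.Icc_subset_Icc_left (by omega)) hi (by simp) (hr i hi)
      fun j hj _ => (hr j hj).le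
  linarith

theorem PrefixFeasible.mono_rate {r b d : ℕ → ℝ} {n : ℕ} {R R' : ℝ} {b' : ℕ → ℝ}
    (hr : ∀ i ∈ Finset.Icc 1 n, 0 < r i) (hd : ∀ i ∈ Finset.Icc 1 n, 0 < d i)
    (hc : ∀ i ∈ Finset.Icc 1 n, 0 < R - ∑ j ∈ Finset.Icc (i + 1) n, r j)
    (hRR : R ≤ R') (h : PrefixFeasible r b d n R n 0 b') : PrefixFeasible r b d n R' n 0 b' := by
  obtain ⟨h1, hbd, hdel⟩ := h
  refine ⟨h1, hbd, fun i hi => ?_⟩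
  have hci := hc i hi
  have hcc := sub_le_sub_right hRR (∑ j ∈ Finset.Icc (i + 1) n, r j)
  have hB : 0 ≤ ∑ j ∈ Finset.Icc (i + 1) n, b' j + 0 := by
    rw [add_zero]
    refine Finset.sum_nonneg fun j hj => (hbd j ?_).1
    rw [Finset.mem_Icc] at hi hj ⊢
    omega
  have hdel' := hdel i hi
  rw [delay_le_iff hci (hr i hi)] at hdel'
  rw [delay_le_iff (hci.trans_le hcc) (hr i hi)]
  refine ⟨hdel'.1.trans (mul_le_mul_of_nonneg_left hcc (hd i hi).le), le_trans ?_ hdel'.2⟩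
  have := mul_le_mul_of_nonneg_left (div_le_div_of_nonneg_left hB hci hcc) (hr i hi).le
  linarith

/-- Without reshaping (`b' = b`) every sufficiently large rate is feasible. -/
theorem exists_optsFeasible {r b d : ℕ → ℝ} {n : ℕ}
    (hr : ∀ i ∈ Finset.Icc 1 n, 0 < r i) (hb : ∀ i ∈ Finset.Icc 1 n, 0 < b i)
    (hd : ∀ i ∈ Finset.Icc 1 n, 0 < d i) : ∃ R, OPTSFeasible r b d n R b := by
  obtain ⟨M, hM⟩ := ((Finset.Icc 1 n).image fun i => ∑ j ∈ Finset.Icc (i + 1) n, r j +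
    (b i + ∑ j ∈ Finset.Icc (i + 1) n, b j) / d i).exists_le
  have hR : ∑ j ∈ Finset.Icc 1 n, r j ≤ max M (∑ j ∈ Finset.Icc 1 n, r j) := le_max_right _ _
  refine ⟨max M (∑ j ∈ Finset.Icc 1 n, r j), hR, rfl, fun i hi => ?_, fun i hi => ?_⟩
  · have := hb i (Finset.Icc_subset_Icc_left one_le_two hi)
    exact ⟨this.le, le_rfl⟩
  · have hci := residual_rate_pos_of_sum_le hr hR i hi
    have hi' := (hM _ (Finset.mem_image_of_mem _ hi)).trans
      (le_max_left M (∑ j ∈ Finset.Icc 1 n, r j))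
    rw [← le_sub_iff_add_le', div_le_iff₀ (hd i hi), mul_comm] at hi'
    rw [delay_le_iff hci (hr i hi)]
    have := mul_div_le_of_le_mul hci (hr i hi)
      (show ∑ j ∈ Finset.Icc (i + 1) n, b j ≤ _ by linarith [hb i hi])
    exact ⟨hi', by linarith⟩

theorem csInf_Ici_inter_of_isUpperSet {T : Set ℝ} (hT : IsUpperSet T) (hbdd : BddBelow T)
    (hne : T.Nonempty) (a : ℝ) : sInf (Set.Ici a ∩ T) = max a (sInf T) := by
  have hlb : BddBelow (Set.Ici a ∩ T) := ⟨a, fun _ h => h.1⟩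
  obtain ⟨t, ht⟩ := hne
  refine le_antisymm (le_of_forall_gt_imp_ge_of_dense fun c hc => ?_) ?_
  · obtain ⟨s, hs, hsc⟩ := exists_lt_of_csInf_lt ⟨t, ht⟩ ((le_max_right a _).trans_lt hc)
    exact csInf_le hlb ⟨(le_max_left a _).trans hc.le, hT hsc.le hs⟩
  · refine le_csInf ⟨max a t, le_max_left a t, hT (le_max_right a t) ht⟩ fun x hx => ?_
    exact max_le hx.1 (csInf_le hbdd hx.2)

/-- Proposition 5.4 and Lemma C.3: for every `R ≥ R_1`, OPT_S is feasible at
`R` iff every element of `S_n(R)` is nonnegative; consequently the minimum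
feasible bandwidth equals `max{R_1, inf{R : ∀ s ∈ S_n(R), s ≥ 0}}`. -/
theorem OPTS_feasibility_characterization
    (n : ℕ) (hn : 2 ≤ n) (r b d : ℕ → ℝ)
    (hr : ∀ i ∈ Finset.Icc 1 n, 0 < r i) (hb : ∀ i ∈ Finset.Icc 1 n, 0 < b i)
    (hd : ∀ i ∈ Finset.Icc 1 n, 0 < d i)
    (hdec : ∀ i ∈ Finset.Icc 1 n, ∀ j ∈ Finset.Icc 1 n, i < j → d j < d i) :
    (∀ R : ℝ, (∑ j ∈ Finset.Icc 1 n, r j) ≤ R →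
      ((∃ b' : ℕ → ℝ, OPTSFeasible r b d n R b') ↔
        ∀ s ∈ OPTSSets r b d n R n, 0 ≤ s)) ∧
    sInf {R : ℝ | ∃ b' : ℕ → ℝ, OPTSFeasible r b d n R b'} =
      max (∑ j ∈ Finset.Icc 1 n, r j)
        (sInf {R : ℝ | ∀ s ∈ OPTSSets r b d n R n, 0 ≤ s}) := by
  have hchar : ∀ R : ℝ, (∀ i ∈ Finset.Icc 1 n, 0 < R - ∑ j ∈ Finset.Icc (i + 1) n, r j) →
      ((∀ s ∈ OPTSSets r b d n R n, 0 ≤ s) ↔ ∃ b', PrefixFeasible r b d n R n 0 b') :=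
    fun R hc => forall_mem_OPTSSets_iff_exists_prefixFeasible hr hb hc (by omega) le_rfl 0 le_rfl
  have hfeas : ∀ R : ℝ, (∑ j ∈ Finset.Icc 1 n, r j) ≤ R →
      ((∃ b' : ℕ → ℝ, OPTSFeasible r b d n R b') ↔ ∀ s ∈ OPTSSets r b d n R n, 0 ≤ s) := by
    intro R hR
    simp only [optsFeasible_iff_prefixFeasible, hR, true_and]
    exact (hchar R (residual_rate_pos_of_sum_le hr hR)).symm
  refine ⟨hfeas, ?_⟩
  have hset : {R : ℝ | ∃ b' : ℕ → ℝ, OPTSFeasible r b d n R b'} =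
      Set.Ici (∑ j ∈ Finset.Icc 1 n, r j) ∩ {R : ℝ | ∀ s ∈ OPTSSets r b d n R n, 0 ≤ s} := by
    ext R
    exact ⟨fun ⟨b', h⟩ => ⟨h.1, (hfeas R h.1).1 ⟨b', h⟩⟩, fun h => (hfeas R h.1).2 h.2⟩
  rw [hset]
  refine csInf_Ici_inter_of_isUpperSet (fun R R' hRR hS => ?_) ?_ ?_ _
  · have hc := residual_rate_pos_of_OPTSSets_nonneg hb hd hS
    obtain ⟨b', hb'⟩ := (hchar R hc).1 hS
    exact (hchar R' fun i hi => by linarith [hc i hi]).2 ⟨b', hb'.mono_rate hr hd hc hRR⟩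
  · refine ⟨0, fun R hS => ?_⟩
    simpa using (residual_rate_pos_of_OPTSSets_nonneg hb hd hS n
      (Finset.mem_Icc.2 ⟨by omega, le_rfl⟩)).le
  · obtain ⟨R, h⟩ := exists_optsFeasible hr hb hd
    exact ⟨R, (hfeas R h.1).1 ⟨b, h⟩⟩
end

section
/- Assume the OPT_S setting with n ≥ 2 flows, and let R ≥ R_1 be such that OPT_S is feasible at R, i.e., there exists some reshaping vector b'' with (R, b'') feasible. Define b'* recursively from the top priority down by: b'*_n = max{0, b_n − r_n·d_n}; b'*_i = max{0, b_i − r_i·d_i + r_i·B'*_{i+1}/(R − R_{i+1})} for 2 ≤ i ≤ n−1, where B'*_{i+1} = Σ_{j=i+1}^n b'*_j; and b'*_1 = b_1. Then (R, b'*) is feasible for OPT_S. In particular, the recursively defined reshaping parameters of Eq. (9) achieve the minimum required bandwidth R̃*_s. (Proposition 5.5.) -/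
/-- The recursively defined optimal reshaping parameters of Eq. (9):
`b'*_n = max{0, b_n − r_n d_n}`, `b'*_1 = b_1`, and for `2 ≤ i ≤ n − 1`,
`b'*_i = max{0, b_i − r_i d_i + r_i B'*_{i+1}/(R − R_{i+1})}` where
`B'*_{i+1} = Σ_{j=i+1}^n b'*_j`. -/
noncomputable def bstar (r b d : ℕ → ℝ) (n : ℕ) (R : ℝ) (i : ℕ) : ℝ :=
  if i = 1 then b 1
  else if i = n then max 0 (b n - r n * d n)
  else
    max 0 (b i - r i * d i +
      r i * (∑ j ∈ (Finset.Icc (i + 1) n).attach, bstar r b d n R j.1) /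
        (R - ∑ j ∈ Finset.Icc (i + 1) n, r j))
termination_by n - i
decreasing_by
  have hj := j.2
  rw [Finset.mem_Icc] at hj
  omega

/-- For `2 ≤ i ≤ n` the recursion for `b'*_i` has the same shape, including at `i = n`. -/
theorem bstar_eq_max (r b d : ℕ → ℝ) (n : ℕ) (R : ℝ) {i : ℕ} (hi : i ∈ Finset.Icc 2 n) :
    bstar r b d n R i = max 0 (b i - r i * d i +
      r i * (∑ j ∈ Finset.Icc (i + 1) n, bstar r b d n R j) /
        (R - ∑ j ∈ Finset.Icc (i + 1) n, r j)) := by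
  rw [Finset.mem_Icc] at hi
  rw [bstar, if_neg (by omega)]
  split_ifs with h
  · subst h
    simp
  · rw [Finset.sum_attach (Finset.Icc (i + 1) n) (bstar r b d n R)]

/-- The residual bandwidth seen by each flow is positive. -/
theorem residual_bandwidth_pos {r : ℕ → ℝ} {n : ℕ} {R : ℝ}
    (hr : ∀ i ∈ Finset.Icc 1 n, 0 < r i) (hR : (∑ j ∈ Finset.Icc 1 n, r j) ≤ R)
    {i : ℕ} (hi : i ∈ Finset.Icc 1 n) :
    0 < R - ∑ j ∈ Finset.Icc (i + 1) n, r j := by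
  rw [sub_pos]
  refine lt_of_lt_of_le ?_ hR
  have hi' := Finset.mem_Icc.mp hi
  refine Finset.sum_lt_sum_of_subset (i := i) (Finset.Icc_subset_Icc_left (by omega)) hi
    (by simp) (hr i hi) fun j hj _ => (hr j hj).le

/-- The recursive reshaping vector is dominated by every feasible one. -/
theorem bstar_le_of_feasible {r b d : ℕ → ℝ} {n : ℕ} {R : ℝ} {b' : ℕ → ℝ}
    (hr : ∀ i ∈ Finset.Icc 1 n, 0 < r i) (h : OPTSFeasible r b d n R b') :
    ∀ i ∈ Finset.Icc 2 n, bstar r b d n R i ≤ b' i := by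
  obtain ⟨hR, -, hbd, hdelay⟩ := h
  suffices H : ∀ k i, n - i = k → i ∈ Finset.Icc 2 n → bstar r b d n R i ≤ b' i from
    fun i hi => H _ i rfl hi
  intro k
  induction k using Nat.strong_induction_on with
  | _ k ih =>
    intro i hk hi
    have hi' := Finset.mem_Icc.mp hi
    have hi1 : i ∈ Finset.Icc 1 n := Finset.mem_Icc.mpr (by omega)
    have hri := hr i hi1
    have hpos := residual_bandwidth_pos hr hR hi1
    have hsum : ∑ j ∈ Finset.Icc (i + 1) n, bstar r b d n R j ≤
        ∑ j ∈ Finset.Icc (i + 1) n, b' j := by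
      refine Finset.sum_le_sum fun j hj => ?_
      rw [Finset.mem_Icc] at hj
      exact ih (n - j) (by omega) j rfl (Finset.mem_Icc.mpr (by omega))
    have hdel := (le_max_right _ _).trans (hdelay i hi1)
    have hdiv := mul_le_mul_of_nonneg_left (div_le_div_of_nonneg_right hsum hpos.le) hri.le
    have hmul := mul_le_mul_of_nonneg_left hdel hri.le
    rw [mul_add, mul_div_cancel₀ _ hri.ne'] at hmul
    rw [bstar_eq_max r b d n R hi, mul_div_assoc]
    exact max_le (hbd i hi).1 (by linarith)

/-- Proposition 5.5: whenever OPT_S is feasible at bandwidth `R`, the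
recursively defined reshaping parameters `b'*` of Eq. (9) are feasible at `R`;
in particular they achieve the minimum required bandwidth `R̃*_s`. -/
theorem OPTS_recursive_reshaping_feasible
    (n : ℕ) (hn : 2 ≤ n) (r b d : ℕ → ℝ)
    (hr : ∀ i ∈ Finset.Icc 1 n, 0 < r i) (hb : ∀ i ∈ Finset.Icc 1 n, 0 < b i)
    (hd : ∀ i ∈ Finset.Icc 1 n, 0 < d i)
    (hdec : ∀ i ∈ Finset.Icc 1 n, ∀ j ∈ Finset.Icc 1 n, i < j → d j < d i)
    (R : ℝ) (hR : (∑ j ∈ Finset.Icc 1 n, r j) ≤ R)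
    (hfeas : ∃ b'' : ℕ → ℝ, OPTSFeasible r b d n R b'') :
    OPTSFeasible r b d n R (bstar r b d n R) := by
  obtain ⟨b'', hb''⟩ := hfeas
  have hle := bstar_le_of_feasible hr hb''
  obtain ⟨-, -, hbd, hdelay⟩ := hb''
  have hone : bstar r b d n R 1 = b 1 := by
    rw [bstar, if_pos rfl]
  refine ⟨hR, hone, fun i hi => ⟨?_, (hle i hi).trans (hbd i hi).2⟩, fun i hi => ?_⟩
  · rw [bstar_eq_max r b d n R hi]
    exact le_max_left _ _
  have hi' := Finset.mem_Icc.mp hi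
  have hri := hr i hi
  have hpos := residual_bandwidth_pos hr hR hi
  have hsum : ∑ j ∈ Finset.Icc (i + 1) n, bstar r b d n R j ≤
      ∑ j ∈ Finset.Icc (i + 1) n, b'' j := by
    refine Finset.sum_le_sum fun j hj => hle j ?_
    rw [Finset.mem_Icc] at hj ⊢
    omega
  have hfirst : (b i + ∑ j ∈ Finset.Icc (i + 1) n, bstar r b d n R j) /
      (R - ∑ j ∈ Finset.Icc (i + 1) n, r j) ≤ d i :=
    (div_le_div_of_nonneg_right (add_le_add_right hsum (b i)) hpos.le).trans
      ((le_max_left _ _).trans (hdelay i hi))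
  refine max_le hfirst ?_
  rcases eq_or_ne i 1 with rfl | hne
  · rw [hone, sub_self, zero_div, zero_add]
    rw [add_div] at hfirst
    linarith [div_pos (hb 1 hi) hpos]
  · have hge := (le_max_right _ _).trans_eq
      (bstar_eq_max r b d n R (Finset.mem_Icc.mpr ⟨by omega, hi'.2⟩)).symm
    rw [mul_div_assoc] at hge
    rw [← le_sub_iff_add_le, div_le_iff₀ hri]
    linarith
end

section
/- Assume the OPT_F setting with n ≥ 1 flows. Then: (a) every R for which some (R, b') is feasible for OPT_F satisfies R ≥ (Σ_{i=1}^n b_i)·R_1 / (Σ_{i=1}^n r_i·d_i); (b) taking b'_i = b_i for all i, the pair (max{R_1, (Σ_{i=1}^n b_i)/d_n}, b') is feasible for OPT_F. Consequently the minimum feasible bandwidth R̂*_s satisfies max{R_1, (Σ b_i)·R_1/Σ r_i d_i} ≤ R̂*_s ≤ max{R_1, (Σ b_i)/d_n} = R̂*, the bounds used to compute R̂*_s by binary search. (Section 6, bounds surrounding Proposition 6.2.) -/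
/-- Feasibility of `(R, b')` for the FIFO optimization OPT_F with flows
`1, …, n`: `R ≥ R_1`, `0 ≤ b'_i ≤ b_i`, and each flow's worst-case delay
(reshaping delay included) is at most `d_i`. -/
def OPTFFeasible (r b d : ℕ → ℝ) (n : ℕ) (R : ℝ) (b' : ℕ → ℝ) : Prop :=
  (∑ j ∈ Finset.Icc 1 n, r j) ≤ R ∧
  (∀ i ∈ Finset.Icc 1 n, 0 ≤ b' i ∧ b' i ≤ b i) ∧
  ∀ i ∈ Finset.Icc 1 n,
    max ((b i - b' i) / r i + (∑ j ∈ (Finset.Icc 1 n).erase i, b' j) / R)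
        ((∑ j ∈ Finset.Icc 1 n, b' j) / R +
          (b i - b' i) * (∑ j ∈ Finset.Icc 1 n, r j) / (r i * R)) ≤ d i

/-- Summing the delay bounds weighted by `r i` bounds the bandwidth from below. -/
theorem OPTFFeasible.bandwidth_ge {n : ℕ} (hn : 1 ≤ n) {r b d : ℕ → ℝ}
    (hr : ∀ i ∈ Finset.Icc 1 n, 0 < r i) (hd : ∀ i ∈ Finset.Icc 1 n, 0 < d i)
    {R : ℝ} {b' : ℕ → ℝ} (h : OPTFFeasible r b d n R b') :
    (∑ i ∈ Finset.Icc 1 n, b i) * (∑ j ∈ Finset.Icc 1 n, r j) /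
      (∑ i ∈ Finset.Icc 1 n, r i * d i) ≤ R := by
  obtain ⟨hR, -, hdelay⟩ := h
  have hne : (Finset.Icc 1 n).Nonempty := Finset.nonempty_Icc.2 hn
  have hRpos : 0 < R := (Finset.sum_pos hr hne).trans_le hR
  rw [div_le_iff₀ (Finset.sum_pos (fun i hi => mul_pos (hr i hi) (hd i hi)) hne)]
  have hterm : ∀ i ∈ Finset.Icc 1 n,
      r i * (∑ j ∈ Finset.Icc 1 n, b' j) + (b i - b' i) * (∑ j ∈ Finset.Icc 1 n, r j) ≤
        R * (r i * d i) := by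
    intro i hi
    have hri := hr i hi
    have hmul := mul_le_mul_of_nonneg_left ((le_max_right _ _).trans (hdelay i hi))
      (mul_pos hri hRpos).le
    calc _ = _ := by field_simp
      _ ≤ _ := hmul
      _ = _ := by ring
  have hsum := Finset.sum_le_sum hterm
  rw [Finset.sum_add_distrib, ← Finset.sum_mul, ← Finset.sum_mul, ← Finset.mul_sum,
    Finset.sum_sub_distrib] at hsum
  linarith

/-- Without reshaping, the FIFO system is feasible once the bandwidth exceeds both the
total rate and the total burst divided by the smallest deadline. -/
theorem OPTFFeasible.of_no_reshaping {n : ℕ} (hn : 1 ≤ n) {r b d : ℕ → ℝ}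
    (hr : ∀ i ∈ Finset.Icc 1 n, 0 < r i) (hb : ∀ i ∈ Finset.Icc 1 n, 0 < b i)
    (hd : ∀ i ∈ Finset.Icc 1 n, 0 < d i)
    (hdec : ∀ i ∈ Finset.Icc 1 n, ∀ j ∈ Finset.Icc 1 n, i < j → d j < d i) :
    OPTFFeasible r b d n
      (max (∑ j ∈ Finset.Icc 1 n, r j) ((∑ i ∈ Finset.Icc 1 n, b i) / d n)) b := by
  refine ⟨le_max_left _ _, fun i hi => ⟨(hb i hi).le, le_rfl⟩, fun i hi => ?_⟩
  have hn_mem : n ∈ Finset.Icc 1 n := Finset.right_mem_Icc.2 hn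
  have hB := le_max_right (∑ j ∈ Finset.Icc 1 n, r j) ((∑ i ∈ Finset.Icc 1 n, b i) / d n)
  have hRpos := (Finset.sum_pos hr ⟨n, hn_mem⟩).trans_le
    (le_max_left (∑ j ∈ Finset.Icc 1 n, r j) ((∑ i ∈ Finset.Icc 1 n, b i) / d n))
  generalize max (∑ j ∈ Finset.Icc 1 n, r j) ((∑ i ∈ Finset.Icc 1 n, b i) / d n) = R at hB hRpos ⊢
  have hdn : d n ≤ d i := by
    rcases (Finset.mem_Icc.1 hi).2.eq_or_lt with rfl | hlt
    · exact le_rfl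
    · exact (hdec i hi n hn_mem hlt).le
  have hdelay : (∑ j ∈ Finset.Icc 1 n, b j) / R ≤ d i :=
    ((div_le_comm₀ (hd n hn_mem) hRpos).1 hB).trans hdn
  have herase : (∑ j ∈ (Finset.Icc 1 n).erase i, b j) / R ≤
      (∑ j ∈ Finset.Icc 1 n, b j) / R := by
    gcongr ?_ / R
    exact Finset.sum_le_sum_of_subset_of_nonneg (Finset.erase_subset _ _)
      fun j hj _ => (hb j hj).le
  simpa using ⟨herase.trans hdelay, hdelay⟩

/-- Section 6, bounds surrounding Proposition 6.2: (a) any feasible bandwidth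
for OPT_F is at least `(Σ b_i) R_1 / (Σ r_i d_i)`; (b) not reshaping at all
(`b'_i = b_i`) is feasible at `max{R_1, (Σ b_i)/d_n}`; consequently
`max{R_1, (Σ b_i) R_1/(Σ r_i d_i)} ≤ R̂*_s ≤ max{R_1, (Σ b_i)/d_n} = R̂*`. -/
theorem OPTF_bandwidth_bounds
    (n : ℕ) (hn : 1 ≤ n) (r b d : ℕ → ℝ)
    (hr : ∀ i ∈ Finset.Icc 1 n, 0 < r i) (hb : ∀ i ∈ Finset.Icc 1 n, 0 < b i)
    (hd : ∀ i ∈ Finset.Icc 1 n, 0 < d i)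
    (hdec : ∀ i ∈ Finset.Icc 1 n, ∀ j ∈ Finset.Icc 1 n, i < j → d j < d i) :
    (∀ R : ℝ, ∀ b' : ℕ → ℝ, OPTFFeasible r b d n R b' →
      (∑ i ∈ Finset.Icc 1 n, b i) * (∑ j ∈ Finset.Icc 1 n, r j) /
        (∑ i ∈ Finset.Icc 1 n, r i * d i) ≤ R) ∧
    OPTFFeasible r b d n
      (max (∑ j ∈ Finset.Icc 1 n, r j) ((∑ i ∈ Finset.Icc 1 n, b i) / d n)) b ∧
    max (∑ j ∈ Finset.Icc 1 n, r j)
        ((∑ i ∈ Finset.Icc 1 n, b i) * (∑ j ∈ Finset.Icc 1 n, r j) /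
          (∑ i ∈ Finset.Icc 1 n, r i * d i)) ≤
      sInf {R : ℝ | ∃ b' : ℕ → ℝ, OPTFFeasible r b d n R b'} ∧
    sInf {R : ℝ | ∃ b' : ℕ → ℝ, OPTFFeasible r b d n R b'} ≤
      max (∑ j ∈ Finset.Icc 1 n, r j) ((∑ i ∈ Finset.Icc 1 n, b i) / d n) := by
  have hlow := fun R b' (h : OPTFFeasible r b d n R b') => h.bandwidth_ge hn hr hd
  have hfeas := OPTFFeasible.of_no_reshaping hn hr hb hd hdec
  refine ⟨hlow, hfeas, le_csInf ⟨_, b, hfeas⟩ ?_,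
    csInf_le ⟨∑ j ∈ Finset.Icc 1 n, r j, ?_⟩ ⟨b, hfeas⟩⟩
  · rintro R ⟨b', h⟩
    exact max_le h.1 (hlow R b' h)
  · rintro R ⟨b', h⟩
    exact h.1
end

section
/- Let r_1, r_2, b_1, b_2 > 0 and d_1 > d_2 > 0. Say that a bandwidth R is feasible for the two-flow static-priority-with-reshaping problem if R ≥ r_1 + r_2 and there exists b'_2 ∈ [0, b_2] with b_2/R ≤ d_2, (b_2 − b'_2)/r_2 ≤ d_2, and (b_1 + b'_2)/(R − r_2) ≤ d_1. Then R is feasible if and only if R ≥ R̃*_s, where R̃*_s = max{ r_1+r_2, b_2/d_2, (b_1 + b_2 − r_2·d_2)/d_1 + r_2 } when b_2/r_2 ≥ b_1/r_1, and R̃*_s = max{ r_1+r_2, b_2/d_2, (b_1 + max{b_2 − r_2·d_2, 0})/d_1 + r_2 } otherwise. (Eq. (13), the two-flow specialization of Propositions 5.4 and 5.5.) -/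
/-- Feasibility is governed by the smallest admissible reshaped burst `max (b2 - r2 * d2) 0`. -/
theorem exists_reshaped_burst_iff {r1 r2 b1 b2 d1 d2 R : ℝ}
    (hr1 : 0 < r1) (hr2 : 0 < r2) (hb2 : 0 < b2) (hd2 : 0 < d2) (hd1 : 0 < d1)
    (hR : r1 + r2 ≤ R) :
    (∃ b2' : ℝ, 0 ≤ b2' ∧ b2' ≤ b2 ∧
        b2 / R ≤ d2 ∧ (b2 - b2') / r2 ≤ d2 ∧ (b1 + b2') / (R - r2) ≤ d1) ↔
      b2 / d2 ≤ R ∧ (b1 + max (b2 - r2 * d2) 0) / d1 + r2 ≤ R := by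
  have hR0 : 0 < R := by linarith
  have hRr : 0 < R - r2 := by linarith
  have hrd : 0 < r2 * d2 := mul_pos hr2 hd2
  simp only [← le_sub_iff_add_le, div_le_iff₀ hR0, div_le_iff₀ hRr, div_le_iff₀ hr2,
    div_le_iff₀ hd2, div_le_iff₀ hd1]
  constructor
  · rintro ⟨b2', h0, -, hR2, hshape, hdelay⟩
    have hmax : max (b2 - r2 * d2) 0 ≤ b2' := max_le (by linarith) h0
    exact ⟨by linarith, by linarith⟩
  · rintro ⟨hR2, hdelay⟩
    have hle := le_max_left (b2 - r2 * d2) 0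
    exact ⟨max (b2 - r2 * d2) 0, le_max_right _ _, max_le (by linarith) hb2.le,
      by linarith, by linarith, by linarith⟩

/-- Eq. (13), the two-flow specialization of Propositions 5.4 and 5.5: a
bandwidth `R` is feasible for the two-flow static-priority-with-reshaping
problem iff `R ≥ R̃*_s`, where `R̃*_s` is the closed-form expression of
Eq. (13). -/
theorem two_flow_static_priority_reshaping_feasibility
    (r1 r2 b1 b2 d1 d2 : ℝ)
    (hr1 : 0 < r1) (hr2 : 0 < r2) (hb1 : 0 < b1) (hb2 : 0 < b2)
    (hd2 : 0 < d2) (hd : d2 < d1) (R : ℝ) :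
    (r1 + r2 ≤ R ∧ ∃ b2' : ℝ, 0 ≤ b2' ∧ b2' ≤ b2 ∧
        b2 / R ≤ d2 ∧ (b2 - b2') / r2 ≤ d2 ∧ (b1 + b2') / (R - r2) ≤ d1) ↔
      (if b1 / r1 ≤ b2 / r2 then
          max (r1 + r2) (max (b2 / d2) ((b1 + b2 - r2 * d2) / d1 + r2))
        else
          max (r1 + r2) (max (b2 / d2) ((b1 + max (b2 - r2 * d2) 0) / d1 + r2))) ≤ R := by
  have hd1 : 0 < d1 := hd2.trans hd
  split_ifs with h
  all_goals
    simp only [max_le_iff]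
    refine and_congr_right fun hR => ?_
    rw [exists_reshaped_burst_iff hr1 hr2 hb2 hd2 hd1 hR]
  refine and_congr_right fun _ => ?_
  rcases le_total 0 (b2 - r2 * d2) with hb | hb
  · rw [max_eq_left hb, add_sub_assoc]
  · -- No reshaping is needed, and stability alone already meets the deadline of flow 1.
    have hb2d : b2 / r2 ≤ d2 := (div_le_iff₀ hr2).2 (by linarith)
    have hb1r : b1 ≤ d1 * r1 := (div_le_iff₀ hr1).1 (by linarith)
    have hb1d : b1 / d1 ≤ r1 := (div_le_iff₀ hd1).2 (by linarith)
    have hle : (b1 + b2 - r2 * d2) / d1 ≤ b1 / d1 :=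
      div_le_div_of_nonneg_right (by linarith) hd1.le
    rw [max_eq_right hb, add_zero]
    exact ⟨fun _ => by linarith, fun _ => by linarith⟩
end

section
/- Let r_1, r_2, b_1, b_2 > 0 and d_1 > d_2 > 0. Say that a bandwidth R is feasible for the two-flow FIFO-with-reshaping problem if R ≥ r_1 + r_2 and there exist b'_1 ∈ [0, b_1] and b'_2 ∈ [0, b_2] such that max{ (b_1−b'_1)/r_1 + b'_2/R, (b'_1+b'_2)/R + (b_1−b'_1)(r_1+r_2)/(r_1·R) } ≤ d_1 and max{ (b_2−b'_2)/r_2 + b'_1/R, (b'_1+b'_2)/R + (b_2−b'_2)(r_1+r_2)/(r_2·R) } ≤ d_2. Then R is feasible if and only if R ≥ R̂*_s, where R̂*_s = max{ r_1+r_2, b_2/d_2, (b_1+b_2)(r_1+r_2)/(d_1 r_1 + d_2 r_2), (b_1+b_2−d_1 r_1 + √((b_1+b_2−d_1 r_1)² + 4 r_1 d_2 b_2))/(2 d_2) }. (Eq. (15), the two-flow specialization of Propositions 6.2 and 6.3.) -/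
/-- A number `x > 0` is at least the larger root of `a x² - β x - c` (with `a, c > 0`) iff the
quadratic is nonnegative at `x`. -/
lemma quadratic_root_le_iff {a β c x : ℝ} (ha : 0 < a) (hc : 0 < c) (hx : 0 < x) :
    (β + Real.sqrt (β ^ 2 + 4 * a * c)) / (2 * a) ≤ x ↔ β * x + c ≤ a * x ^ 2 := by
  rw [div_le_iff₀ (by positivity), ← le_sub_iff_add_le', Real.sqrt_le_iff]
  constructor
  · rintro ⟨-, h⟩
    refine le_of_mul_le_mul_left ?_ ha
    linarith
  · intro h
    have hβ : 0 < a * x - β := by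
      refine pos_of_mul_pos_left ?_ hx.le
      linarith
    refine ⟨by linarith [mul_pos ha hx], ?_⟩
    linarith [mul_le_mul_of_nonneg_left h ha.le]

/-- The two delay bounds of a flow, cleared of denominators. -/
lemma fifo_delay_le_iff {r s b x y d R : ℝ} (hr : 0 < r) (hR : 0 < R) :
    max ((b - x) / r + y / R) ((x + y) / R + (b - x) * (r + s) / (r * R)) ≤ d ↔
      (b - x) * R + r * y ≤ d * r * R ∧ r * y - s * x + b * (r + s) ≤ d * r * R := by
  have h₁ : (b - x) / r + y / R = ((b - x) * R + r * y) / (r * R) := by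
    field_simp
  have h₂ : (x + y) / R + (b - x) * (r + s) / (r * R)
      = (r * y - s * x + b * (r + s)) / (r * R) := by
    field_simp
    ring
  rw [max_le_iff, h₁, h₂, div_le_iff₀ (by positivity), div_le_iff₀ (by positivity), mul_assoc d]


/-- Eq. (15), the two-flow specialization of Propositions 6.2 and 6.3: a
bandwidth `R` is feasible for the two-flow FIFO-with-reshaping problem iff
`R ≥ R̂*_s`, where `R̂*_s` is the closed-form expression of Eq. (15). -/
theorem two_flow_fifo_reshaping_feasibility
    (r1 r2 b1 b2 d1 d2 : ℝ)
    (hr1 : 0 < r1) (hr2 : 0 < r2) (hb1 : 0 < b1) (hb2 : 0 < b2)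
    (hd2 : 0 < d2) (hd : d2 < d1) (R : ℝ) :
    (r1 + r2 ≤ R ∧ ∃ b1' b2' : ℝ, 0 ≤ b1' ∧ b1' ≤ b1 ∧ 0 ≤ b2' ∧ b2' ≤ b2 ∧
        max ((b1 - b1') / r1 + b2' / R)
            ((b1' + b2') / R + (b1 - b1') * (r1 + r2) / (r1 * R)) ≤ d1 ∧
        max ((b2 - b2') / r2 + b1' / R)
            ((b1' + b2') / R + (b2 - b2') * (r1 + r2) / (r2 * R)) ≤ d2) ↔
      max (max (r1 + r2) (b2 / d2))
        (max ((b1 + b2) * (r1 + r2) / (d1 * r1 + d2 * r2))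
          ((b1 + b2 - d1 * r1 +
              Real.sqrt ((b1 + b2 - d1 * r1) ^ 2 + 4 * r1 * d2 * b2)) /
            (2 * d2))) ≤ R := by
  rw [show 4 * r1 * d2 * b2 = 4 * d2 * (r1 * b2) by ring, max_le_iff, max_le_iff, max_le_iff,
    and_assoc]
  refine and_congr_right fun hs => ?_
  have hR : 0 < R := by linarith
  have hd1 : 0 < d1 := hd2.trans hd
  rw [quadratic_root_le_iff hd2 (by positivity) hR, div_le_iff₀ hd2,
    div_le_iff₀ (by positivity)]
  have key₁ (x y : ℝ) := fifo_delay_le_iff (s := r2) (b := b1) (x := x) (y := y) (d := d1) hr1 hR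
  have key₂ (x y : ℝ) := fifo_delay_le_iff (s := r1) (b := b2) (x := y) (y := x) (d := d2) hr2 hR
  simp only [add_comm r2 r1] at key₂
  have key₂ (x y : ℝ) := add_comm y x ▸ key₂ x y
  simp only [key₁, key₂]
  constructor
  · rintro ⟨x, y, hx0, hx, hy0, hy, ⟨hA, hB⟩, hC, hD⟩
    have hyr := mul_le_mul_of_nonneg_left hy hr1.le
    have hxd : x ≤ d2 * R - b2 := by
      refine le_of_mul_le_mul_left ?_ hr2
      linarith
    refine ⟨by linarith, by linarith, ?_⟩
    have := mul_le_mul_of_nonneg_right hxd (show 0 ≤ R - r2 by linarith)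
    linarith
  · rintro ⟨hb, hsum, hq⟩
    rcases le_total b1 (d2 * R - b2) with h | h
    · have hdR := mul_le_mul_of_nonneg_right hd.le hR.le
      have h₁ := mul_le_mul_of_nonneg_left (show b1 + b2 ≤ d1 * R by linarith) hr1.le
      have h₂ := mul_le_mul_of_nonneg_left h hr2.le
      have hrb₁ := mul_pos hr1 hb1
      have hrb₂ := mul_pos hr2 hb2
      exact ⟨b1, b2, hb1.le, le_rfl, hb2.le, le_rfl, ⟨by linarith, by linarith⟩,
        by linarith, by linarith⟩
    · have hrb₂ := mul_pos hr2 hb2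
      exact ⟨d2 * R - b2, b2, by linarith, h, hb2.le, le_rfl, ⟨by linarith, by linarith⟩,
        by linarith, by linarith⟩
end

section
/- Let r_1, r_2, b_1, b_2 > 0 and d_1 > d_2 > 0, and let R* (Eq. (10)) and R̃*_s (Eq. (13)) be the two-flow closed-form minimum bandwidths for the optimal dynamic-priority scheduler and for static priority with optimal reshaping, respectively. Then R* ≤ R̃*_s always, and R* < R̃*_s if and only if b_2/r_2 < d_2 and d_1 < b_1/r_1. (Section 7.1.1, dynamic priority vs. static priority with reshaping.) -/
/-- Section 7.1.1, dynamic priority vs. static priority with reshaping: in the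
two-flow case, `R* ≤ R̃*_s` always, and `R* < R̃*_s` iff `b_2/r_2 < d_2` and
`d_1 < b_1/r_1`. -/
theorem dynamic_vs_static_with_reshaping_two_flows
    (r1 r2 b1 b2 d1 d2 Rstar Rts : ℝ)
    (hr1 : 0 < r1) (hr2 : 0 < r2) (hb1 : 0 < b1) (hb2 : 0 < b2)
    (hd2 : 0 < d2) (hd : d2 < d1)
    (hRstar : Rstar = max (r1 + r2) (max (b2 / d2) ((b1 + b2 - r2 * d2) / d1 + r2)))
    (hRts : Rts =
      if b1 / r1 ≤ b2 / r2 then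
        max (r1 + r2) (max (b2 / d2) ((b1 + b2 - r2 * d2) / d1 + r2))
      else
        max (r1 + r2) (max (b2 / d2) ((b1 + max (b2 - r2 * d2) 0) / d1 + r2))) :
    Rstar ≤ Rts ∧ (Rstar < Rts ↔ b2 / r2 < d2 ∧ d1 < b1 / r1) := by
  have hd1 : 0 < d1 := hd2.trans hd
  subst hRstar hRts
  split_ifs with h
  · refine ⟨le_rfl, fun hlt => absurd hlt (lt_irrefl _), fun ⟨h2, h1⟩ => ?_⟩
    linarith
  rcases le_or_gt (r2 * d2) b2 with hb | hb
  · rw [max_eq_left (sub_nonneg.2 hb), ← add_sub_assoc]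
    refine ⟨le_rfl, fun hlt => absurd hlt (lt_irrefl _), fun ⟨h2, _⟩ => ?_⟩
    rw [div_lt_iff₀ hr2] at h2
    linarith
  · rw [max_eq_right (sub_nonpos.2 hb.le), add_zero]
    have hthird : (b1 + b2 - r2 * d2) / d1 < b1 / d1 := by
      gcongr
      linarith
    have hsecond : b2 / d2 < r2 := (div_lt_iff₀ hd2).2 hb
    have h2 : b2 / r2 < d2 := (div_lt_iff₀ hr2).2 (by linarith)
    have h1 : d1 < b1 / r1 ↔ r1 < b1 / d1 := lt_div_comm₀ hd1 hr1
    rw [h1]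
    refine ⟨by gcongr, fun hlt => ⟨h2, ?_⟩, fun ⟨_, hr⟩ => ?_⟩
    · by_contra! hle
      refine hlt.not_ge (max_le (le_max_left _ _) (le_max_of_le_left (max_le ?_ ?_))) <;> linarith
    · refine lt_max_of_lt_right (lt_max_of_lt_right (max_lt ?_ (max_lt ?_ ?_))) <;> linarith
end

section
/- Let r_1, r_2, b_1, b_2 > 0 and d_1 > d_2 > 0, and let R* (Eq. (10)) and R̂*_s (Eq. (15)) be the two-flow closed-form minimum bandwidths for the optimal dynamic-priority scheduler and for FIFO with optimal reshaping, respectively. Then R̂*_s > R* if and only if d_1 − b_1/r_1 < d_2 < (b_1 + b_2 − d_1·r_1)/r_2. (Section 7.1.1, dynamic priority vs. FIFO with reshaping.) -/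
/-- A positive `x` lies below the positive root of `a z² - p z - c` iff the quadratic is
negative at `x`. -/
theorem lt_pos_root_iff {a p c x : ℝ} (ha : 0 < a) (hc : 0 < c) (hx : 0 < x) :
    x < (p + Real.sqrt (p ^ 2 + 4 * a * c)) / (2 * a) ↔ a * x ^ 2 - p * x - c < 0 := by
  rw [lt_div_iff₀ (by positivity)]
  constructor
  · intro h
    by_contra! hf
    have hpos : 0 < a * x - p := by
      by_contra! hneg
      nlinarith [mul_nonneg hx.le (sub_nonneg.2 hneg)]
    have hle : Real.sqrt (p ^ 2 + 4 * a * c) ≤ 2 * a * x - p := by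
      apply Real.sqrt_le_iff.2
      constructor
      · nlinarith [mul_pos ha hx]
      · nlinarith [mul_nonneg ha.le hf]
    linarith
  · intro hf
    have hlt : 2 * a * x - p < Real.sqrt (p ^ 2 + 4 * a * c) := by
      apply Real.lt_sqrt_of_sq_lt
      nlinarith [mul_pos ha (neg_pos.2 hf)]
    linarith

/-- Section 7.1.1, dynamic priority vs. FIFO with reshaping: in the two-flow
case, `R̂*_s > R*` iff `d_1 − b_1/r_1 < d_2 < (b_1 + b_2 − d_1 r_1)/r_2`. -/
theorem dynamic_vs_fifo_with_reshaping_two_flows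
    (r1 r2 b1 b2 d1 d2 Rstar Rfs : ℝ)
    (hr1 : 0 < r1) (hr2 : 0 < r2) (hb1 : 0 < b1) (hb2 : 0 < b2)
    (hd2 : 0 < d2) (hd : d2 < d1)
    (hRstar : Rstar = max (r1 + r2) (max (b2 / d2) ((b1 + b2 - r2 * d2) / d1 + r2)))
    (hRfs : Rfs = max (max (r1 + r2) (b2 / d2))
      (max ((b1 + b2) * (r1 + r2) / (d1 * r1 + d2 * r2))
        ((b1 + b2 - d1 * r1 +
            Real.sqrt ((b1 + b2 - d1 * r1) ^ 2 + 4 * r1 * d2 * b2)) /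
          (2 * d2)))) :
    Rstar < Rfs ↔ (d1 - b1 / r1 < d2 ∧ d2 < (b1 + b2 - d1 * r1) / r2) := by
  have hd1 : 0 < d1 := hd2.trans hd
  have hD : 0 < d1 * r1 + d2 * r2 := by positivity
  have hgap : 0 < d1 - d2 := sub_pos.2 hd
  have hC1 : d1 - b1 / r1 < d2 ↔ r1 * (d1 - d2) < b1 := by
    rw [sub_lt_comm, lt_div_iff₀ hr1, mul_comm]
  have hC2 : d2 < (b1 + b2 - d1 * r1) / r2 ↔ d1 * r1 + d2 * r2 < b1 + b2 := by
    rw [lt_div_iff₀ hr2]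
    constructor <;> intro h <;> linarith
  have hdisc : 4 * r1 * d2 * b2 = 4 * d2 * (r1 * b2) := by ring
  rw [hdisc] at hRfs
  have hroot := fun x (hx : 0 < x) =>
    lt_pos_root_iff (p := b1 + b2 - d1 * r1) hd2 (mul_pos hr1 hb2) hx
  set Y := (b1 + b2) * (r1 + r2) / (d1 * r1 + d2 * r2) with hY
  set Z := (b1 + b2 - d1 * r1 +
    Real.sqrt ((b1 + b2 - d1 * r1) ^ 2 + 4 * d2 * (r1 * b2))) / (2 * d2)
  set X := (b1 + b2 - r2 * d2) / d1 + r2 with hX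
  have hYR : r1 + r2 < Y ↔ d1 * r1 + d2 * r2 < b1 + b2 := by
    rw [hY, lt_div_iff₀ hD, mul_comm, mul_lt_mul_iff_left₀ (by positivity)]
  have hZb : b2 / d2 < Z ↔ r1 * (d1 - d2) < b1 := by
    rw [hroot _ (div_pos hb2 hd2)]
    have heq : d2 * (b2 / d2) ^ 2 - (b1 + b2 - d1 * r1) * (b2 / d2) - r1 * b2
        = b2 / d2 * (r1 * (d1 - d2) - b1) := by
      field_simp
      ring
    rw [heq, ← sub_neg (a := r1 * (d1 - d2)), mul_neg_iff]
    have hpos := div_pos hb2 hd2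
    simp [hpos, hpos.not_gt]
  have hXY : d1 * r1 + d2 * r2 < b1 + b2 → X < Y := by
    intro h
    have hX' : X = (b1 + b2 + r2 * (d1 - d2)) / d1 := by
      rw [hX]
      field_simp
      ring
    rw [hX', hY, div_lt_div_iff₀ hd1 hD]
    nlinarith [mul_pos (mul_pos hr2 hgap) (sub_pos.2 h)]
  rw [hC1, hC2, hRstar, hRfs]
  constructor
  · intro h
    simp only [max_lt_iff, lt_max_iff] at h
    rcases h with (⟨hR, -, -⟩ | ⟨-, hb, -⟩) | ⟨hR, hb, -⟩ | ⟨hR, hb, -⟩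
    · exact absurd hR (lt_irrefl _)
    · exact absurd hb (lt_irrefl _)
    · have h2 := hYR.1 hR
      refine ⟨?_, h2⟩
      contrapose! hb with h1
      have hb2' : d2 * (r1 + r2) ≤ b2 := by nlinarith
      rw [hY, div_le_div_iff₀ hD hd2]
      have hm := mul_le_mul h1 hb2' (by positivity) (by positivity)
      nlinarith
    · have h1 := hZb.1 hb
      refine ⟨h1, ?_⟩
      have hf := (hroot _ (by positivity)).1 hR
      contrapose! hf with h2
      have hb2' : b2 ≤ d2 * (r1 + r2) := by nlinarith
      nlinarith [mul_nonneg (sub_nonneg.2 h2) (add_pos hr1 hr2).le,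
        mul_nonneg hr1.le (sub_nonneg.2 hb2')]
  · rintro ⟨h1, h2⟩
    have hY1 := hYR.2 h2
    have hZ1 := hZb.2 h1
    have hX1 := hXY h2
    simp only [max_lt_iff, lt_max_iff]
    rcases lt_or_ge (b2 / d2) Y with h | h
    · exact .inr (.inl ⟨hY1, h, hX1⟩)
    · exact .inr (.inr ⟨by linarith, hZ1, by linarith⟩)
end

section
/- Let r_1, r_2, b_1, b_2 > 0 and d_1 > d_2 > 0, and let R̂* (Eq. (14)) and R̂*_s (Eq. (15)) be the two-flow closed-form minimum bandwidths for FIFO without and with optimal reshaping, respectively. Then R̂*_s ≤ R̂* always, and R̂*_s < R̂* if and only if d_2 < (b_1 + b_2)/(r_1 + r_2); i.e., for a FIFO scheduler, reshaping strictly decreases the required bandwidth exactly when the smaller deadline d_2 is below (b_1+b_2)/(r_1+r_2). (Section 7.1.2, benefits of reshaping under FIFO.) -/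
/-- Section 7.1.2, benefits of reshaping under FIFO: in the two-flow case,
`R̂*_s ≤ R̂*` always, and `R̂*_s < R̂*` iff `d_2 < (b_1 + b_2)/(r_1 + r_2)`. -/
theorem fifo_reshaping_benefit_two_flows
    (r1 r2 b1 b2 d1 d2 Rf Rfs : ℝ)
    (hr1 : 0 < r1) (hr2 : 0 < r2) (hb1 : 0 < b1) (hb2 : 0 < b2)
    (hd2 : 0 < d2) (hd : d2 < d1)
    (hRf : Rf = max (r1 + r2) ((b1 + b2) / d2))
    (hRfs : Rfs = max (max (r1 + r2) (b2 / d2))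
      (max ((b1 + b2) * (r1 + r2) / (d1 * r1 + d2 * r2))
        ((b1 + b2 - d1 * r1 +
            Real.sqrt ((b1 + b2 - d1 * r1) ^ 2 + 4 * r1 * d2 * b2)) /
          (2 * d2)))) :
    Rfs ≤ Rf ∧ (Rfs < Rf ↔ d2 < (b1 + b2) / (r1 + r2)) := by
  have hb2_lt : b2 / d2 < (b1 + b2) / d2 := by gcongr; linarith
  have hdr : d2 * r1 < d1 * r1 := by gcongr
  have hratio : (b1 + b2) * (r1 + r2) / (d1 * r1 + d2 * r2) < (b1 + b2) / d2 := by
    have hpos : 0 < d1 * r1 + d2 * r2 := by nlinarith [mul_pos hd2 hr1, mul_pos hd2 hr2]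
    rw [div_lt_div_iff₀ hpos hd2, mul_assoc]
    exact mul_lt_mul_of_pos_left (by linarith) (by linarith)
  have hsqrt : Real.sqrt ((b1 + b2 - d1 * r1) ^ 2 + 4 * r1 * d2 * b2) <
      b1 + b2 + d1 * r1 := by
    rw [Real.sqrt_lt' (by nlinarith [mul_pos hd2 hr1])]
    nlinarith [mul_lt_mul_of_pos_right hdr hb2, mul_pos (mul_pos (hd2.trans hd) hr1) hb1]
  have hroot : (b1 + b2 - d1 * r1 +
      Real.sqrt ((b1 + b2 - d1 * r1) ^ 2 + 4 * r1 * d2 * b2)) / (2 * d2) <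
      (b1 + b2) / d2 := by
    rw [div_lt_div_iff₀ (by positivity) hd2]
    nlinarith
  subst hRf hRfs
  refine ⟨max_le (max_le_max le_rfl hb2_lt.le)
    ((max_lt hratio hroot).le.trans (le_max_right _ _)), ?_⟩
  rw [lt_div_comm₀ hd2 (by positivity)]
  constructor
  · intro h
    by_contra! hle
    rw [max_eq_left hle] at h
    exact h.not_ge ((le_max_left _ _).trans (le_max_left _ _))
  · intro h
    rw [max_eq_right h.le]
    exact max_lt (max_lt h hb2_lt) (max_lt hratio hroot)
end

section
/- Let r_1, r_2, b_1, b_2 > 0 and d_1 > d_2 > 0, and let R̃*_s (Eq. (13)) and R̂*_s (Eq. (15)) be the two-flow closed-form minimum bandwidths for static priority with optimal reshaping and FIFO with optimal reshaping, respectively. Then R̃*_s > R̂*_s if and only if d_1 ∈ (b_2/r_2, b_1/r_1) and d_2 ∈ ( (b_1+b_2)(r_1+r_2)/(r_2·(b_1/d_1 + r_2)) − d_1·r_1/r_2 , d_1 ). (Proposition E.1 of Appendix E: when grouping both flows in a single FIFO class beats strict priority separation.) -/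
/-- The larger root of `a x² - c x - e` lies below `T` once the quadratic is positive at `T`. -/
theorem quadratic_root_lt_of_pos {a c e T : ℝ} (ha : 0 < a) (he : 0 ≤ e) (hT : 0 < T)
    (h : 0 < a * T ^ 2 - c * T - e) :
    (c + Real.sqrt (c ^ 2 + 4 * a * e)) / (2 * a) < T := by
  have hc : 0 < 2 * a * T - c := by
    by_contra! hn
    nlinarith [mul_nonneg hT.le (sub_nonneg.2 hn), mul_pos ha (pow_pos hT 2)]
  have hs : Real.sqrt (c ^ 2 + 4 * a * e) < 2 * a * T - c := by
    rw [Real.sqrt_lt' hc]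
    nlinarith [mul_pos ha h]
  rw [div_lt_iff₀ (by positivity)]
  linarith

/-- If the static-priority delay bound without truncation exceeds `r₁ + r₂`, then the FIFO
aggregate delay bound is at least as large. -/
theorem untruncated_priority_le_fifo {r1 r2 S d1 d2 : ℝ}
    (hr1 : 0 < r1) (hr2 : 0 < r2) (hd2 : 0 < d2) (hd : d2 < d1)
    (h : r1 + r2 < (S - r2 * d2) / d1 + r2) :
    (S - r2 * d2) / d1 + r2 ≤ S * (r1 + r2) / (d1 * r1 + d2 * r2) := by
  have hd1 : 0 < d1 := hd2.trans hd
  have hS : r1 * d1 < S - r2 * d2 := (lt_div_iff₀ hd1).1 (by linarith)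
  rw [div_add' _ _ _ hd1.ne', div_le_div_iff₀ hd1 (by positivity)]
  nlinarith [mul_pos (mul_pos hr2 (sub_pos.2 hd)) (sub_pos.2 hS)]

/-- The lower endpoint of the interval for `d₂`, with the denominators cleared. -/
theorem endpoint_lt_iff {r1 r2 S T d1 d2 : ℝ} (hr2 : 0 < r2) (hT : 0 < T) :
    S * (r1 + r2) / (r2 * T) - d1 * r1 / r2 < d2 ↔
      S * (r1 + r2) < T * (d1 * r1 + d2 * r2) := by
  rw [sub_lt_iff_lt_add, div_lt_iff₀ (by positivity)]
  have : (d2 + d1 * r1 / r2) * (r2 * T) = T * (d1 * r1 + d2 * r2) := by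
    field_simp
    ring
  rw [this]


/-- Proposition E.1 of Appendix E: in the two-flow case, FIFO with optimal
reshaping strictly beats static priority with optimal reshaping
(`R̃*_s > R̂*_s`) iff `d_1 ∈ (b_2/r_2, b_1/r_1)` and
`d_2 ∈ ((b_1+b_2)(r_1+r_2)/(r_2 (b_1/d_1 + r_2)) − d_1 r_1/r_2, d_1)`. -/
theorem fifo_beats_static_priority_two_flows
    (r1 r2 b1 b2 d1 d2 Rts Rfs : ℝ)
    (hr1 : 0 < r1) (hr2 : 0 < r2) (hb1 : 0 < b1) (hb2 : 0 < b2)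
    (hd2 : 0 < d2) (hd : d2 < d1)
    (hRts : Rts =
      if b1 / r1 ≤ b2 / r2 then
        max (r1 + r2) (max (b2 / d2) ((b1 + b2 - r2 * d2) / d1 + r2))
      else
        max (r1 + r2) (max (b2 / d2) ((b1 + max (b2 - r2 * d2) 0) / d1 + r2)))
    (hRfs : Rfs = max (max (r1 + r2) (b2 / d2))
      (max ((b1 + b2) * (r1 + r2) / (d1 * r1 + d2 * r2))
        ((b1 + b2 - d1 * r1 +
            Real.sqrt ((b1 + b2 - d1 * r1) ^ 2 + 4 * r1 * d2 * b2)) /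
          (2 * d2)))) :
    Rfs < Rts ↔
      (b2 / r2 < d1 ∧ d1 < b1 / r1) ∧
      ((b1 + b2) * (r1 + r2) / (r2 * (b1 / d1 + r2)) - d1 * r1 / r2 < d2 ∧ d2 < d1) := by
  have hd1 : 0 < d1 := hd2.trans hd
  have hT : 0 < b1 / d1 + r2 := by positivity
  have hD : 0 < d1 * r1 + d2 * r2 := by positivity
  rw [endpoint_lt_iff hr2 hT, div_lt_iff₀ hr2, lt_div_iff₀ hr1, hRts, hRfs]
  constructor
  · rw [max_lt_iff, max_lt_iff, max_lt_iff]
    rintro ⟨⟨h1, h2⟩, h3, -⟩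
    have untruncated_absurd : ¬ max (max (r1 + r2) (b2 / d2))
        ((b1 + b2) * (r1 + r2) / (d1 * r1 + d2 * r2)) <
        max (r1 + r2) (max (b2 / d2) ((b1 + b2 - r2 * d2) / d1 + r2)) := by
      simp only [max_lt_iff, lt_max_iff, lt_irrefl, false_and, and_false, false_or]
      rintro ⟨⟨h, -⟩, h'⟩
      exact (untruncated_priority_le_fifo hr1 hr2 hd2 hd h).not_gt h'
    split_ifs at h1 h2 h3 with hb
    · exact absurd (max_lt (max_lt h1 h2) h3) untruncated_absurd
    · rcases le_total 0 (b2 - r2 * d2) with hp | hp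
      · rw [max_eq_left hp, ← add_sub_assoc] at h1 h2 h3
        exact absurd (max_lt (max_lt h1 h2) h3) untruncated_absurd
      · rw [max_eq_right hp, add_zero] at h1 h2 h3
        have hbd : b2 / d2 ≤ r2 := by rw [div_le_iff₀ hd2]; linarith
        have hbT : b2 / d2 < b1 / d1 + r2 := by linarith [div_pos hb1 hd1]
        rw [max_eq_right hbT.le] at h1 h3
        have h1' := (lt_max_iff.1 h1).resolve_left (lt_irrefl _)
        rw [max_eq_right h1'.le, div_lt_iff₀ hD] at h3
        have h4 : r1 * d1 < b1 := (lt_div_iff₀ hd1).1 (by linarith)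
        exact ⟨⟨by nlinarith, by linarith⟩, h3, hd⟩
  · rintro ⟨⟨h1, h2⟩, h3, -⟩
    have hTd : (b1 / d1 + r2) * d1 = b1 + r2 * d1 := by field_simp
    have hp : b2 < r2 * d2 := by
      have hprod := mul_pos (sub_pos.2 h1) (sub_pos.2 h2)
      have : 0 < (b1 / d1 + r2) * d1 * (r2 * d2 - b2) := by
        rw [hTd]
        have h3' := mul_lt_mul_of_pos_right h3 hd1
        have : (b1 / d1 + r2) * (d1 * r1 + d2 * r2) * d1
            = (b1 + r2 * d1) * (d1 * r1 + d2 * r2) := by rw [← hTd]; ring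
        nlinarith
      exact sub_pos.1 (pos_of_mul_pos_right this (by positivity))
    have hb : ¬ b1 / r1 ≤ b2 / r2 := by
      rw [not_le]
      exact ((div_lt_iff₀ hr2).2 h1).trans ((lt_div_iff₀ hr1).2 h2)
    rw [if_neg hb, max_eq_right (by linarith : b2 - r2 * d2 ≤ 0), add_zero]
    have hr : r1 < b1 / d1 := (lt_div_iff₀ hd1).2 (by linarith)
    have hbd : b2 / d2 < r2 := by rw [div_lt_iff₀ hd2]; exact hp
    refine lt_max_of_lt_right (lt_max_of_lt_right ?_)
    refine max_lt (max_lt (by linarith) (by linarith)) (max_lt ((div_lt_iff₀ hD).2 h3) ?_)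
    have hroot := quadratic_root_lt_of_pos (c := b1 + b2 - d1 * r1) (e := r1 * b2)
      hd2 (by positivity) hT ?_
    · rwa [show 4 * r1 * d2 * b2 = 4 * d2 * (r1 * b2) by ring]
    · have hmain : 0 < r2 * (d2 * (b1 / d1 + r2) ^ 2 - (b1 + b2 - d1 * r1) * (b1 / d1 + r2)
          - r1 * b2) := by
        have hgap := mul_pos hT (sub_pos.2 h3)
        have hpos : 0 < r1 * b2 * (b1 / d1) := by positivity
        have hid : r2 * (d2 * (b1 / d1 + r2) ^ 2 - (b1 + b2 - d1 * r1) * (b1 / d1 + r2)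
            - r1 * b2) = (b1 / d1 + r2) * ((b1 / d1 + r2) * (d1 * r1 + d2 * r2)
              - (b1 + b2) * (r1 + r2)) + r1 * b2 * (b1 / d1) := by
          field_simp
          ring
        linarith
      exact pos_of_mul_pos_right hmain hr2.le
end

section
/- Let 0 < r_2 ≤ r'_2, 0 ≤ b'_2 ≤ b_2, R > r_2, and l_1, l_2 ≥ 0. Define for t ≥ 0 the shaper delay D_1(t) = max(0, (b_2 − b'_2 + r_2·t)/r'_2 − t) and the total delay Δ(t) = D_1(t) + (l_1 + l_2)/R + max(0, (b_2 + r_2·t − l_2)/R − t − D_1(t)). Then sup_{t ≥ 0} Δ(t) = max{ (b_2 + l_1)/R , (b_2 − b'_2)/r'_2 + (l_1 + l_2)/R }. That is, in the packet-based two-flow static-priority model, the worst-case delay of the high-priority flow (r_2, b_2) reshaped by (r'_2, b'_2) and sharing a non-preemptive priority link of bandwidth R with a low-priority flow of maximum packet length l_1 is max{(b_2+l_1)/R, (b_2−b'_2)/r'_2 + (l_1+l_2)/R}. (Proposition E.1 / delay-h of Appendix E.) -/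
/-- Proposition delay-h of Appendix E: in the packet-based two-flow
static-priority model, the worst-case delay of the high-priority flow
`(r_2, b_2)` reshaped by `(r'_2, b'_2)` and sharing a non-preemptive priority
link of bandwidth `R` with a low-priority flow of maximum packet length `l_1`
is `max{(b_2 + l_1)/R, (b_2 − b'_2)/r'_2 + (l_1 + l_2)/R}`. -/
theorem packet_high_priority_worst_case_delay
    (r2 r2' b2 b2' R l1 l2 : ℝ)
    (hr2 : 0 < r2) (hr : r2 ≤ r2') (hb0 : 0 ≤ b2') (hb : b2' ≤ b2)
    (hR : r2 < R) (hl1 : 0 ≤ l1) (hl2 : 0 ≤ l2)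
    (D1 Δ : ℝ → ℝ)
    (hD1 : ∀ t : ℝ, D1 t = max 0 ((b2 - b2' + r2 * t) / r2' - t))
    (hΔ : ∀ t : ℝ, Δ t =
      D1 t + (l1 + l2) / R + max 0 ((b2 + r2 * t - l2) / R - t - D1 t)) :
    sSup {y : ℝ | ∃ t : ℝ, 0 ≤ t ∧ y = Δ t} =
      max ((b2 + l1) / R) ((b2 - b2') / r2' + (l1 + l2) / R) := by
  have hr2' : 0 < r2' := hr2.trans_le hr
  have hR0 : 0 < R := hr2.trans hR
  have hmax (t : ℝ) :
      Δ t = max (D1 t) ((b2 + r2 * t - l2) / R - t) + (l1 + l2) / R := by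
    have hsplit := max_add_add_left (D1 t) 0 ((b2 + r2 * t - l2) / R - t - D1 t)
    rw [add_zero, add_sub_cancel] at hsplit
    rw [hΔ, hsplit]
    ring
  have hzero : D1 0 = (b2 - b2') / r2' := by
    rw [hD1, mul_zero, add_zero, sub_zero]
    exact max_eq_right (div_nonneg (sub_nonneg.2 hb) hr2'.le)
  have hslope {c t : ℝ} (hc : 0 < c) (hle : r2 ≤ c) (ht : 0 ≤ t) :
      r2 * t / c ≤ t := by
    rw [div_le_iff₀ hc, mul_comm t]
    exact mul_le_mul_of_nonneg_right hle ht
  have hΔ0 : Δ 0 = max ((b2 + l1) / R) ((b2 - b2') / r2' + (l1 + l2) / R) := by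
    rw [hmax, hzero, ← max_add_add_right, max_comm]
    congr 1
    ring
  rw [← hΔ0]
  refine IsGreatest.csSup_eq ⟨⟨0, le_rfl, rfl⟩, ?_⟩
  rintro y ⟨t, ht, rfl⟩
  rw [hmax, hmax]
  gcongr ?_ + _
  refine max_le_max ?_ ?_
  · rw [hzero, hD1, add_div]
    refine max_le (div_nonneg (sub_nonneg.2 hb) hr2'.le) ?_
    linarith [hslope hr2' hr ht]
  · rw [mul_zero, add_zero, sub_zero, add_sub_right_comm, add_div]
    linarith [hslope hR0 hR.le ht]
end

section
/- Let r_1 > 0, b_1 > 0, 0 < r_2 ≤ r'_2, 0 ≤ b'_2 < b_2, and R > r_1 + r_2. Define β_1(0) = 0 and β_1(t) = max(0, R·t − min(b_2 + r_2·t, b'_2 + r'_2·t)) for t > 0, and the virtual delay D(t) = inf{τ ≥ 0 : b_1 + r_1·t ≤ β_1(t + τ)} for t ≥ 0. Then sup_{t ≥ 0} D(t) equals: (1) (b_1 + b'_2)/(R − r_2) when r'_2 = r_2; (2) (b_1 + b_2)/(R − r_2) when r'_2 > r_2 and (R − r'_2)(b_2 − b'_2)/(r'_2 − r_2) − (b_1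 + b'_2) < 0; and (3) max{ (b_1 + b'_2)/(R − r'_2) , (b_1 + b_2)/r_1 − (R − r_1 − r_2)(b_2 − b'_2)/(r_1·(r'_2 − r_2)) } when r'_2 > r_2 and (R − r'_2)(b_2 − b'_2)/(r'_2 − r_2) − (b_1 + b'_2) ≥ 0. (Proposition delay-l of Appendix E: worst-case delay of the low-priority flow.) -/
/-- If `V ≥ 0` is a feasible value for every index and a lower bound of the feasible values for
some index, then `V` is the supremum of the infima of feasible nonnegative values. -/
theorem sSup_sInf_eq_of_feasible {P : ℝ → ℝ → Prop} {V : ℝ} (hV : 0 ≤ V)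
    (hfeas : ∀ t, 0 ≤ t → P t V)
    (hlow : ∃ t, 0 ≤ t ∧ ∀ τ, 0 ≤ τ → P t τ → V ≤ τ) :
    sSup {y : ℝ | ∃ t : ℝ, 0 ≤ t ∧ y = sInf {τ : ℝ | 0 ≤ τ ∧ P t τ}} = V := by
  refine IsGreatest.csSup_eq ⟨?_, ?_⟩
  · obtain ⟨t, ht, h⟩ := hlow
    have hleast : IsLeast {τ : ℝ | 0 ≤ τ ∧ P t τ} V :=
      ⟨⟨hV, hfeas t ht⟩, fun τ hτ => h τ hτ.1 hτ.2⟩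
    exact ⟨t, ht, hleast.csInf_eq.symm⟩
  · rintro y ⟨t, ht, rfl⟩
    exact csInf_le ⟨0, fun τ hτ => hτ.1⟩ ⟨hV, hfeas t ht⟩

/-- Proposition delay-l of Appendix E: worst-case delay of the low-priority
flow `(r_1, b_1)` when the high-priority flow `(r_2, b_2)`, reshaped by a
greedy leaky-bucket shaper `(r'_2, b'_2)`, shares a static-priority link of
bandwidth `R > r_1 + r_2`, the low-priority flow receiving the leftover
service curve `β_1(t) = [R t − min{γ_{r_2,b_2}(t), γ_{r'_2,b'_2}(t)}]⁺`. -/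
theorem packet_low_priority_worst_case_delay
    (r1 b1 r2 r2' b2 b2' R : ℝ)
    (hr1 : 0 < r1) (hb1 : 0 < b1) (hr2 : 0 < r2) (hr : r2 ≤ r2')
    (hb0 : 0 ≤ b2') (hb : b2' < b2) (hR : r1 + r2 < R)
    (β1 : ℝ → ℝ) (hβ0 : β1 0 = 0)
    (hβ : ∀ t : ℝ, 0 < t →
      β1 t = max 0 (R * t - min (b2 + r2 * t) (b2' + r2' * t)))
    (W : ℝ)
    (hW : W = sSup {y : ℝ | ∃ t : ℝ, 0 ≤ t ∧
      y = sInf {τ : ℝ | 0 ≤ τ ∧ b1 + r1 * t ≤ β1 (t + τ)}}) :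
    (r2' = r2 → W = (b1 + b2') / (R - r2)) ∧
    (r2 < r2' → (R - r2') * (b2 - b2') / (r2' - r2) - (b1 + b2') < 0 →
      W = (b1 + b2) / (R - r2)) ∧
    (r2 < r2' → 0 ≤ (R - r2') * (b2 - b2') / (r2' - r2) - (b1 + b2') →
      W = max ((b1 + b2') / (R - r2'))
        ((b1 + b2) / r1 - (R - r1 - r2) * (b2 - b2') / (r1 * (r2' - r2)))) := by
  have key : ∀ t s : ℝ, 0 ≤ t → 0 ≤ s →
      (b1 + r1 * t ≤ β1 s ↔
        b1 + b2 + r1 * t ≤ (R - r2) * s ∨ b1 + b2' + r1 * t ≤ (R - r2') * s) := by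
    intro t s ht hs
    have hpos : 0 < b1 + r1 * t := by positivity
    rcases hs.eq_or_lt with rfl | hs
    · rw [hβ0]
      constructor
      · intro h; linarith
      · rintro (h | h) <;> linarith
    · rw [hβ s hs, le_max_iff, le_sub_comm, min_le_iff]
      constructor
      · rintro (h | h | h)
        · linarith
        · left; linarith
        · right; linarith
      · rintro (h | h)
        · right; left; linarith
        · right; right; linarith
  have hRr : 0 < R - r2 := by linarith
  have main : ∀ V : ℝ, 0 ≤ V →
      (∀ t, 0 ≤ t → b1 + b2 + r1 * t ≤ (R - r2) * (t + V) ∨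
        b1 + b2' + r1 * t ≤ (R - r2') * (t + V)) →
      (∃ t, 0 ≤ t ∧ ∀ τ, 0 ≤ τ → (b1 + b2 + r1 * t ≤ (R - r2) * (t + τ) ∨
        b1 + b2' + r1 * t ≤ (R - r2') * (t + τ)) → V ≤ τ) → W = V := by
    rintro V hV hfeas ⟨t₀, ht₀, hlow⟩
    rw [hW]
    exact sSup_sInf_eq_of_feasible (P := fun t τ => b1 + r1 * t ≤ β1 (t + τ)) hV
      (fun t ht => (key t _ ht (by linarith)).2 (hfeas t ht))
      ⟨t₀, ht₀, fun τ hτ h => hlow τ hτ ((key t₀ _ ht₀ (by linarith)).1 h)⟩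
  refine ⟨?_, ?_, ?_⟩
  · rintro rfl
    refine main _ (by positivity) (fun t ht => Or.inr ?_) ⟨0, le_rfl, fun τ hτ h => ?_⟩
    · rw [mul_add, mul_div_cancel₀ _ hRr.ne']
      nlinarith
    · rw [div_le_iff₀ hRr]
      rcases h with h | h <;> linarith
  · intro hlt hneg
    have hd : 0 < r2' - r2 := sub_pos.2 hlt
    have hb2 : 0 < b2 := by linarith
    refine main _ (by positivity) (fun t ht => Or.inl ?_) ⟨0, le_rfl, fun τ hτ h => ?_⟩
    · rw [mul_add, mul_div_cancel₀ _ hRr.ne']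
      nlinarith
    · rw [div_le_iff₀ hRr]
      simp only [mul_zero, add_zero, zero_add] at h
      rcases h with h | h
      · linarith
      · rw [mul_div_assoc] at hneg
        set T := (b2 - b2') / (r2' - r2) with hT
        have hTd : T * (r2' - r2) = b2 - b2' := div_mul_cancel₀ _ hd.ne'
        have hc : 0 < R - r2' := by
          by_contra hc
          nlinarith
        have hτT : T < τ := by
          by_contra hc'
          nlinarith
        nlinarith
  · intro hlt hpos
    have hd : 0 < r2' - r2 := sub_pos.2 hlt
    rw [mul_div_assoc] at hpos
    have hrw : (b1 + b2) / r1 - (R - r1 - r2) * (b2 - b2') / (r1 * (r2' - r2)) =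
        (b2 - b2') / (r2' - r2) -
          ((R - r2') * ((b2 - b2') / (r2' - r2)) - (b1 + b2')) / r1 := by
      field_simp
      ring
    rw [hrw]
    have hT0 : 0 < (b2 - b2') / (r2' - r2) := div_pos (sub_pos.2 hb) hd
    set T := (b2 - b2') / (r2' - r2) with hT
    have hTd : T * (r2' - r2) = b2 - b2' := div_mul_cancel₀ _ hd.ne'
    have hc : 0 < R - r2' := by
      by_contra hc
      nlinarith
    set u := ((R - r2') * T - (b1 + b2')) / r1 with hu
    have hu0 : 0 ≤ u := div_nonneg hpos hr1.le
    have hur : u * r1 = (R - r2') * T - (b1 + b2') := div_mul_cancel₀ _ hr1.ne'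
    set B := (b1 + b2') / (R - r2') with hB
    have hB0 : 0 ≤ B := by positivity
    have hBm : B * (R - r2') = b1 + b2' := div_mul_cancel₀ _ hc.ne'
    refine main _ (hB0.trans (le_max_left _ _)) (fun t ht => ?_) ?_
    · have hVB := le_max_left B (T - u)
      have hVT := le_max_right B (T - u)
      set V := max B (T - u)
      rcases le_total t u with htu | htu
      · right
        rcases le_total r1 (R - r2') with h1 | h1
        · nlinarith
        · nlinarith
      · left
        nlinarith
    · rcases le_total (T - u) B with h1 | h1
      · rw [max_eq_left h1]
        refine ⟨0, le_rfl, fun τ hτ h => ?_⟩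
        simp only [mul_zero, add_zero, zero_add] at h
        rw [hB, div_le_iff₀ hc]
        rcases h with h | h
        · rcases le_total T τ with h2 | h2
          · nlinarith
          · nlinarith
        · linarith
      · rw [max_eq_right h1]
        refine ⟨u, hu0, fun τ hτ h => ?_⟩
        by_contra! h2
        have h3 : 0 < T - (u + τ) := by linarith
        rcases h with h | h
        · nlinarith [mul_pos hRr h3]
        · nlinarith [mul_pos hc h3]
end
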